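/- arXiv:2405.15408 — 5 statements merged into one kernel-verified Lean document; each statement's English description precedes it below -/
import Mathlib

section
/- Let Σ¹, Σ², Σ³ be antisymmetric real 4×4 matrices such that ∑_{μ,ν,ρ,σ∈{1,2,3,4}} ε_{μνρσ} Σⁱ_{μν} Σʲ_{ρσ} = 8 v δ^{ij} for all i,j ∈ {1,2,3} and some real number v ≠ 0 (i.e. the associated 2-forms satisfy Σⁱ∧Σʲ = 2δ^{ij}·vol for a nowhere-vanishing 4-form vol), and suppose the orientation condition holds: for all X, Y ∈ ℝ⁴ with ∑_μ X_μ Σ¹_{μν} = ∑_μ Y_μ Σ²_{μν} for every ν, one has ∑_{μ,ν} Σ³_{μν} X_μ Y_ν ≤ 0. Then there exists an invertible matrix P ∈ GL(4,ℝ) such that Pᵀ Σⁱ P = Sⁱ for i = 1,2,3, where Sⁱ are the canonical matrices. -/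
open Matrix BigOperators

/-- Levi-Civita symbol on four indices (values in `{1,2,3,4}` encoded as `Fin 4`),
totally antisymmetric with `ε 0 1 2 3 = 1`. -/
noncomputable def eps4 (μ ν ρ σ : Fin 4) : ℝ :=
  Matrix.det (Matrix.of fun a b => if ![μ, ν, ρ, σ] a = b then (1 : ℝ) else 0)

/-- The canonical matrices `S¹, S², S³`: antisymmetric with
`S¹₍₄₁₎ = 1, S¹₍₂₃₎ = −1, S²₍₄₂₎ = 1, S²₍₃₁₎ = −1, S³₍₄₃₎ = 1, S³₍₁₂₎ = −1`
(indices `1,2,3,4` encoded as `0,1,2,3`). -/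
def Scan : Fin 3 → Matrix (Fin 4) (Fin 4) ℝ :=
  ![!![0, 0, 0, -1; 0, 0, -1, 0; 0, 1, 0, 0; 1, 0, 0, 0],
    !![0, 0, 1, 0; 0, 0, 0, -1; -1, 0, 0, 0; 0, 1, 0, 0],
    !![0, -1, 0, 0; 1, 0, 0, 0; 0, 0, 0, -1; 0, 0, 1, 0]]


theorem eps4_eq (μ ν ρ σ : Fin 4) : eps4 μ ν ρ σ =
    (((((ν : ℕ) : ℤ) - (μ : ℕ)) * ((ρ : ℕ) - (μ : ℕ)) * ((σ : ℕ) - (μ : ℕ)) *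
      ((ρ : ℕ) - (ν : ℕ)) * ((σ : ℕ) - (ν : ℕ)) * ((σ : ℕ) - (ρ : ℕ))) / 12 : ℤ) := by
  have h : ∀ μ ν ρ σ : Fin 4,
      Matrix.det (Matrix.of fun a b : Fin 4 => if ![μ, ν, ρ, σ] a = b then (1 : ℤ) else 0) =
      (((((ν : ℕ) : ℤ) - (μ : ℕ)) * ((ρ : ℕ) - (μ : ℕ)) * ((σ : ℕ) - (μ : ℕ)) *
      ((ρ : ℕ) - (ν : ℕ)) * ((σ : ℕ) - (ν : ℕ)) * ((σ : ℕ) - (ρ : ℕ))) / 12) := by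
    intro μ ν ρ σ
    rw [Matrix.det_succ_row_zero]
    simp only [Matrix.det_fin_three, Fin.sum_univ_four]
    revert μ ν ρ σ
    decide +kernel
  rw [← h, eps4, Int.cast_det]
  congr 1
  ext a b
  simp only [Matrix.map_apply, Matrix.of_apply]
  split_ifs <;> simp

/-- Hodge dual of an antisymmetric matrix. -/
def hodge (A : Matrix (Fin 4) (Fin 4) ℝ) : Matrix (Fin 4) (Fin 4) ℝ :=
  !![0, A 2 3, -A 1 3, A 1 2; -A 2 3, 0, A 0 3, -A 0 2;
     A 1 3, -A 0 3, 0, A 0 1; -A 1 2, A 0 2, -A 0 1, 0]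

theorem anti_entries {A : Matrix (Fin 4) (Fin 4) ℝ} (hA : Aᵀ = -A) :
    A = !![0, A 0 1, A 0 2, A 0 3; -A 0 1, 0, A 1 2, A 1 3;
      -A 0 2, -A 1 2, 0, A 2 3; -A 0 3, -A 1 3, -A 2 3, 0] := by
  have h : ∀ i j, A j i = - A i j := fun i j => by
    have := congrFun (congrFun hA i) j
    simpa using this
  have h0 : ∀ i, A i i = 0 := fun i => by linarith [h i i]
  ext i j
  fin_cases i <;> fin_cases j <;> simp [h0] <;> apply h

theorem hodge_transpose (A : Matrix (Fin 4) (Fin 4) ℝ) : (hodge A)ᵀ = - hodge A := by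
  ext i j
  fin_cases i <;> fin_cases j <;> simp [hodge]

theorem wedge_eq {A B : Matrix (Fin 4) (Fin 4) ℝ} (hA : Aᵀ = -A) (hB : Bᵀ = -B) :
    (∑ μ, ∑ ν, ∑ ρ, ∑ σ, eps4 μ ν ρ σ * A μ ν * B ρ σ) =
    4 * (A 0 1 * B 2 3 + A 2 3 * B 0 1 - A 0 2 * B 1 3 - A 1 3 * B 0 2
      + A 0 3 * B 1 2 + A 1 2 * B 0 3) := by
  have h : ∀ {A : Matrix (Fin 4) (Fin 4) ℝ}, Aᵀ = -A → ∀ i j, A j i = - A i j :=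
    fun hA i j => by
      have := congrFun (congrFun hA i) j
      simpa using this
  simp only [eps4_eq, Fin.sum_univ_four]
  rw [h hA 0 1, h hA 0 2, h hA 0 3, h hA 1 2, h hA 1 3, h hA 2 3,
    h hB 0 1, h hB 0 2, h hB 0 3, h hB 1 2, h hB 1 3, h hB 2 3]
  norm_num
  ring

theorem hodge_polar {A B : Matrix (Fin 4) (Fin 4) ℝ} (hA : Aᵀ = -A) (hB : Bᵀ = -B) (w : ℝ)
    (h : (∑ μ, ∑ ν, ∑ ρ, ∑ σ, eps4 μ ν ρ σ * A μ ν * B ρ σ) = 8 * w) :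
    A * hodge B + B * hodge A = (-2 * w) • (1 : Matrix (Fin 4) (Fin 4) ℝ) := by
  rw [wedge_eq hA hB] at h
  have hw : w = (A 0 1 * B 2 3 + A 2 3 * B 0 1 - A 0 2 * B 1 3 - A 1 3 * B 0 2
      + A 0 3 * B 1 2 + A 1 2 * B 0 3) / 2 := by linarith
  rw [hw, anti_entries hA, anti_entries hB]
  ext i j
  fin_cases i <;> fin_cases j <;>
    simp [hodge, Matrix.mul_apply, Fin.sum_univ_four] <;> ring

section
variable {A B C a b c : Matrix (Fin 4) (Fin 4) ℝ}

/-- Main linear algebra step, given inverses and anticommutation relations. -/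
theorem canonical_of_inverses (hA : Aᵀ = -A) (hB : Bᵀ = -B) (hC : Cᵀ = -C)
    (Aa : A * a = 1) (Bb : B * b = 1) (Cc : C * c = 1)
    (aA : a * A = 1) (bB : b * B = 1) (cC : c * C = 1)
    (tb : bᵀ = -b)
    (AB : a * B = - (b * A)) (BC : b * C = -(c * B)) (CA : c * A = -(a * C))
    (AB' : A * b = - (B * a)) (BC' : B * c = -(C * b))
    (u : Fin 4 → ℝ) (hu : u ⬝ᵥ (A * (b * C)) *ᵥ u = 1) :
    ∃ P : Matrix (Fin 4) (Fin 4) ℝ, IsUnit P.det ∧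
      Pᵀ * A * P = Scan 0 ∧ Pᵀ * B * P = Scan 1 ∧ Pᵀ * C * P = Scan 2 := by
  obtain ⟨M1, h1⟩ : ∃ M, M = b * C := ⟨_, rfl⟩
  obtain ⟨M2, h2⟩ : ∃ M, M = c * A := ⟨_, rfl⟩
  obtain ⟨M3, h3⟩ : ∃ M, M = a * B := ⟨_, rfl⟩
  obtain ⟨g, hg⟩ : ∃ g, g = A * M1 := ⟨_, rfl⟩
  have m12 : M1 * M2 = -M3 := by
    rw [h1, h2, h3, AB, neg_neg, mul_assoc, ← mul_assoc C, Cc, one_mul]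
  have m23 : M2 * M3 = -M1 := by
    rw [h1, h2, h3, BC, neg_neg, mul_assoc, ← mul_assoc A, Aa, one_mul]
  have m31 : M3 * M1 = -M2 := by
    rw [h1, h2, h3, CA, neg_neg, mul_assoc, ← mul_assoc B, Bb, one_mul]
  have m11 : M1 * M1 = -1 := by
    conv_lhs => rw [h1]; arg 1; rw [BC]
    rw [neg_mul, mul_assoc, ← mul_assoc B, Bb, one_mul, cC]
  have m22 : M2 * M2 = -1 := by
    conv_lhs => rw [h2]; arg 1; rw [CA]
    rw [neg_mul, mul_assoc, ← mul_assoc C, Cc, one_mul, aA]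
  have m33 : M3 * M3 = -1 := by
    conv_lhs => rw [h3]; arg 1; rw [AB]
    rw [neg_mul, mul_assoc, ← mul_assoc A, Aa, one_mul, bB]
  have m21 : M2 * M1 = M3 := by
    have : M2 * (M2 * M3) = M2 * (-M1) := by rw [m23]
    rw [← mul_assoc, m22] at this
    simpa using this.symm
  have m32 : M3 * M2 = M1 := by
    have : M3 * (M3 * M1) = M3 * (-M2) := by rw [m31]
    rw [← mul_assoc, m33] at this
    simpa using this.symm
  have m13 : M1 * M3 = M2 := by
    have : M1 * (M1 * M2) = M1 * (-M3) := by rw [m12]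
    rw [← mul_assoc, m11] at this
    simpa using this.symm
  have AM3 : A * M3 = B := by rw [h3, ← mul_assoc, Aa, one_mul]
  have BM1 : B * M1 = C := by rw [h1, ← mul_assoc, Bb, one_mul]
  have gA : A = -(g * M1) := by rw [hg, mul_assoc, m11]; simp
  have gB : B = -(g * M2) := by rw [hg, mul_assoc, m12, mul_neg, AM3, neg_neg]
  have gC : C = -(g * M3) := by
    rw [hg, mul_assoc, m13, ← BM1, ← AM3, mul_assoc, m31, mul_neg]
  have gT : gᵀ = g := by
    have e1 : gᵀ = -(C * b) * A := by
      rw [hg, h1]; simp [Matrix.transpose_mul, hA, hC, tb, mul_assoc]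
    rw [e1, ← BC', mul_assoc, CA, hg, h1, ← mul_assoc, AB', mul_neg, neg_mul, mul_assoc]
  have tr : ∀ {D M : Matrix (Fin 4) (Fin 4) ℝ}, Dᵀ = -D → D = -(g * M) →
      Mᵀ * g = -(g * M) := by
    intro D M hD e
    have := congrArg Matrix.transpose e
    rw [hD, e, Matrix.transpose_neg, Matrix.transpose_mul, gT] at this
    exact (neg_injective this).symm
  have t1 := tr hA gA
  have t2 := tr hB gB
  have t3 := tr hC gC
  have zero : ∀ {D M : Matrix (Fin 4) (Fin 4) ℝ}, Dᵀ = -D → D = -(g * M) →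
      u ⬝ᵥ (g * M) *ᵥ u = 0 := by
    intro D M hD e
    have e' : g * M = -D := by rw [e, neg_neg]
    have h : u ⬝ᵥ D *ᵥ u = - (u ⬝ᵥ D *ᵥ u) := by
      conv_lhs => rw [dotProduct_comm, ← Matrix.vecMul_transpose, hD,
        ← Matrix.dotProduct_mulVec, Matrix.neg_mulVec, dotProduct_neg]
    rw [e', Matrix.neg_mulVec, dotProduct_neg]
    linarith
  have z1 := zero hA gA
  have z2 := zero hB gB
  have z3 := zero hC gC
  have z0 : u ⬝ᵥ g *ᵥ u = 1 := by rw [hg, h1]; exact hu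
  obtain ⟨N, hN⟩ : ∃ N : Fin 4 → Matrix (Fin 4) (Fin 4) ℝ, N = ![M1, M2, M3, 1] := ⟨_, rfl⟩
  obtain ⟨P, hP⟩ : ∃ P : Matrix (Fin 4) (Fin 4) ℝ, P = Matrix.of fun i j => (N j *ᵥ u) i :=
    ⟨_, rfl⟩
  have hMP : ∀ (M : Matrix (Fin 4) (Fin 4) ℝ) i j, (M * P) i j = ((M * N j) *ᵥ u) i := by
    intro M i j
    rw [← Matrix.mulVec_mulVec, hP]
    rfl
  have hPg : Pᵀ * g * P = 1 := by
    ext i j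
    have : (Pᵀ * g * P) i j = u ⬝ᵥ ((N i)ᵀ * g * N j) *ᵥ u := by
      have e : (Pᵀ * g * P) i j = (N i *ᵥ u) ⬝ᵥ ((g * N j) *ᵥ u) := by
        rw [mul_assoc, Matrix.mul_apply, dotProduct]
        refine Finset.sum_congr rfl fun k _ => ?_
        rw [hMP, hP]
        rfl
      rw [e, ← Matrix.vecMul_transpose, ← Matrix.dotProduct_mulVec, Matrix.mulVec_mulVec,
        mul_assoc]
    rw [this, hN]
    fin_cases i <;> fin_cases j <;>
      simp [t1, t2, t3, mul_assoc, m11, m12, m13, m21, m22, m23, m31, m32, m33, z0, z1, z2, z3,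
        Matrix.neg_mulVec]
  have fin : ∀ {D M S : Matrix (Fin 4) (Fin 4) ℝ}, D = -(g * M) → M * P = P * (-S) →
      Pᵀ * D * P = S := by
    intro D M S e e2
    rw [e, mul_neg, neg_mul, ← mul_assoc, mul_assoc, e2, ← mul_assoc, hPg]
    simp
  refine ⟨P, ?_, fin gA ?_, fin gB ?_, fin gC ?_⟩
  · have : P.det * (g.det * P.det) = 1 := by
      have := congrArg Matrix.det hPg
      rw [Matrix.det_mul, Matrix.det_mul, Matrix.det_transpose, Matrix.det_one] at this
      linarith
    exact IsUnit.of_mul_eq_one _ this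
  all_goals
    ext i j
    rw [hMP, Matrix.mul_apply, Fin.sum_univ_four, hP, hN]
    fin_cases j <;>
      simp [Scan, m11, m12, m13, m21, m22, m23, m31, m32, m33, Matrix.neg_mulVec]
end

/-- an oriented `SU(2)`-structure (a triple of antisymmetric 4×4
matrices with `Σⁱ ∧ Σʲ = 2δ^{ij} vol` for a nowhere vanishing `vol`, satisfying
the orientation condition) can be brought to the canonical form by a
`GL(4,ℝ)` transformation. -/
theorem su2_structure_canonical_form
    (Sig : Fin 3 → Matrix (Fin 4) (Fin 4) ℝ)
    (hanti : ∀ i, (Sig i)ᵀ = -Sig i)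
    (v : ℝ) (hv : v ≠ 0)
    (hwedge : ∀ i j, (∑ μ, ∑ ν, ∑ ρ, ∑ σ, eps4 μ ν ρ σ * Sig i μ ν * Sig j ρ σ)
      = 8 * v * (if i = j then 1 else 0))
    (horient : ∀ X Y : Fin 4 → ℝ,
      (∀ ν, (∑ μ, X μ * Sig 0 μ ν) = ∑ μ, Y μ * Sig 1 μ ν) →
      (∑ μ, ∑ ν, Sig 2 μ ν * X μ * Y ν) ≤ 0) :
    ∃ P : Matrix (Fin 4) (Fin 4) ℝ, IsUnit P.det ∧
      ∀ i, Pᵀ * Sig i * P = Scan i := by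
  have pol : ∀ i j, Sig i * hodge (Sig j) + Sig j * hodge (Sig i) =
      (-2 * (v * if i = j then 1 else 0)) • (1 : Matrix (Fin 4) (Fin 4) ℝ) := fun i j =>
    hodge_polar (hanti i) (hanti j) _ (by rw [hwedge]; ring)
  obtain ⟨inv, hinv⟩ : ∃ f : Fin 3 → Matrix (Fin 4) (Fin 4) ℝ,
      f = fun i => (-v⁻¹) • hodge (Sig i) := ⟨_, rfl⟩
  have tinv : ∀ i, (inv i)ᵀ = - inv i := fun i => by
    rw [hinv]; simp [hodge_transpose]
  have hR : ∀ i, Sig i * inv i = 1 := fun i => by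
    have h := pol i i
    rw [if_pos rfl, ← two_smul ℝ] at h
    have h2 : Sig i * hodge (Sig i) = (-v) • (1 : Matrix (Fin 4) (Fin 4) ℝ) := by
      have := congrArg (fun M => (2⁻¹ : ℝ) • M) h
      simp only [smul_smul] at this
      norm_num at this
      simpa using this
    rw [hinv]
    simp only [Matrix.mul_smul, h2, smul_smul]
    rw [neg_mul_neg, inv_mul_cancel₀ hv, one_smul]
  have hL : ∀ i, inv i * Sig i = 1 := fun i => mul_eq_one_comm.mp (hR i)
  have hX : ∀ i j, i ≠ j → Sig i * inv j = -(Sig j * inv i) := fun i j hij => by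
    have h := pol i j
    rw [if_neg hij] at h
    simp only [mul_zero, zero_smul] at h
    rw [hinv]
    simp only [Matrix.mul_smul]
    rw [eq_neg_of_add_eq_zero_left h, smul_neg]
  have hX' : ∀ i j, i ≠ j → inv i * Sig j = -(inv j * Sig i) := fun i j hij => by
    have h := congrArg Matrix.transpose (hX i j hij)
    rw [Matrix.transpose_neg, Matrix.transpose_mul, Matrix.transpose_mul, hanti, hanti, tinv,
      tinv, neg_mul_neg, neg_mul_neg] at h
    rw [h, neg_neg]
  have nonneg : ∀ y : Fin 4 → ℝ, 0 ≤ y ⬝ᵥ (Sig 0 * (inv 1 * Sig 2)) *ᵥ y := by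
    intro y
    have h := horient ((inv 0 * Sig 1) *ᵥ y) y (by
      intro ν
      have e : ((inv 0 * Sig 1) *ᵥ y) ᵥ* Sig 0 = y ᵥ* Sig 1 := by
        rw [← Matrix.vecMul_transpose, Matrix.vecMul_vecMul, Matrix.transpose_mul, hanti, tinv,
          neg_mul_neg, mul_assoc, hL, mul_one]
      exact congrFun e ν)
    have e : (∑ μ, ∑ ν, Sig 2 μ ν * ((inv 0 * Sig 1) *ᵥ y) μ * y ν) =
        ((inv 0 * Sig 1) *ᵥ y) ⬝ᵥ (Sig 2 *ᵥ y) := by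
      generalize (inv 0 * Sig 1) *ᵥ y = x
      simp only [dotProduct, Matrix.mulVec, Finset.mul_sum]
      refine Finset.sum_congr rfl fun _ _ => Finset.sum_congr rfl fun _ _ => ?_
      ring
    rw [e, ← Matrix.vecMul_transpose, ← Matrix.dotProduct_mulVec, Matrix.mulVec_mulVec,
      Matrix.transpose_mul, hanti, tinv, neg_mul_neg, hX 1 0 (by decide), neg_mul,
      Matrix.neg_mulVec, dotProduct_neg, mul_assoc] at h
    linarith
  obtain ⟨g, hg⟩ : ∃ g, g = Sig 0 * (inv 1 * Sig 2) := ⟨_, rfl⟩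
  rw [← hg] at nonneg
  have gT : gᵀ = g := by
    have e1 : gᵀ = -(Sig 2 * inv 1) * Sig 0 := by
      rw [hg]; simp [Matrix.transpose_mul, hanti, tinv, mul_assoc]
    rw [e1, ← hX 1 2 (by decide), mul_assoc, hX' 2 0 (by decide), hg, ← mul_assoc,
      hX 0 1 (by decide), mul_neg, neg_mul, mul_assoc]
  have ginv : g * (inv 2 * Sig 1 * inv 0) = 1 := by
    have e : g * (inv 2 * Sig 1 * inv 0) =
        Sig 0 * (inv 1 * ((Sig 2 * inv 2) * Sig 1)) * inv 0 := by
      rw [hg]; simp only [mul_assoc]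
    rw [e, hR, one_mul, hL, mul_one, hR]
  have ex : ∃ y : Fin 4 → ℝ, 0 < y ⬝ᵥ g *ᵥ y := by
    by_contra hcon
    push Not at hcon
    have h0 : ∀ y : Fin 4 → ℝ, y ⬝ᵥ g *ᵥ y = 0 := fun y => le_antisymm (hcon y) (nonneg y)
    have hb : ∀ x y : Fin 4 → ℝ, x ⬝ᵥ g *ᵥ y = 0 := by
      intro x y
      have h1 := h0 (x + y)
      have hs : y ⬝ᵥ g *ᵥ x = x ⬝ᵥ g *ᵥ y := by
        conv_lhs => rw [dotProduct_comm, ← Matrix.vecMul_transpose, gT,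
          ← Matrix.dotProduct_mulVec]
      simp only [Matrix.mulVec_add, dotProduct_add, add_dotProduct, h0, hs] at h1
      linarith
    have g0 : g = 0 := by
      ext i j
      simpa using hb (Pi.single i 1) (Pi.single j 1)
    rw [g0, zero_mul] at ginv
    exact zero_ne_one ginv
  obtain ⟨y, hy⟩ := ex
  obtain ⟨P, hdet, p0, p1, p2⟩ := canonical_of_inverses (hanti 0) (hanti 1) (hanti 2)
    (hR 0) (hR 1) (hR 2) (hL 0) (hL 1) (hL 2) (tinv 1)
    (hX' 0 1 (by decide)) (hX' 1 2 (by decide)) (hX' 2 0 (by decide))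
    (hX 0 1 (by decide)) (hX 1 2 (by decide))
    ((Real.sqrt (y ⬝ᵥ g *ᵥ y))⁻¹ • y) (by
      rw [← hg, Matrix.mulVec_smul, dotProduct_smul, smul_dotProduct, smul_eq_mul, smul_eq_mul,
        ← mul_assoc, ← mul_inv, Real.mul_self_sqrt hy.le, inv_mul_cancel₀ hy.ne'])
  refine ⟨P, hdet, fun i => ?_⟩
  fin_cases i
  · exact p0
  · exact p1
  · exact p2
end

section
/- Let Σ¹, Σ², Σ³ be antisymmetric real 4×4 matrices such that ∑_{μ,ν,ρ,σ∈{1,2,3,4}} ε_{μνρσ} Σⁱ_{μν} Σʲ_{ρσ} = 8 v δ^{ij} for all i,j ∈ {1,2,3} and some real number v ≠ 0. Then there exist an invertible matrix P ∈ GL(4,ℝ) and a sign s ∈ {+1, −1} such that Pᵀ Σ¹ P = S¹, Pᵀ Σ² P = S², and Pᵀ Σ³ P = s·S³, where Sⁱ are the canonical matrices. -/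
open Matrix BigOperators

/-- The explicit (Hodge-type) dual of a 4×4 matrix. -/
def dualM (A : Matrix (Fin 4) (Fin 4) ℝ) : Matrix (Fin 4) (Fin 4) ℝ :=
  !![0, A 2 3, -A 1 3, A 1 2; -A 2 3, 0, A 0 3, -A 0 2;
     A 1 3, -A 0 3, 0, A 0 1; -A 1 2, A 0 2, -A 0 1, 0]

/-- Half of the polarised Pfaffian. -/
def pfB (A B : Matrix (Fin 4) (Fin 4) ℝ) : ℝ :=
  A 0 1 * B 2 3 - A 0 2 * B 1 3 + A 0 3 * B 1 2
    + A 2 3 * B 0 1 - A 1 3 * B 0 2 + A 1 2 * B 0 3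

/-- Integer cofactor expansion of the Levi-Civita symbol. -/
def dl (a b : Fin 4) : ℤ := if a = b then 1 else 0

/-- The 3×3 minor of three standard rows on columns `p q r`. -/
def minor3 (b c d p q r : Fin 4) : ℤ :=
  dl b p * dl c q * dl d r - dl b p * dl c r * dl d q - dl b q * dl c p * dl d r
    + dl b q * dl c r * dl d p + dl b r * dl c p * dl d q - dl b r * dl c q * dl d p

/-- Cofactor expansion along the first row. -/
def eps4Z (a b c d : Fin 4) : ℤ :=
  dl a 0 * minor3 b c d 1 2 3 - dl a 1 * minor3 b c d 0 2 3
    + dl a 2 * minor3 b c d 0 1 3 - dl a 3 * minor3 b c d 0 1 2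

lemma eps4_eq_cast (a b c d : Fin 4) : eps4 a b c d = (eps4Z a b c d : ℝ) := by
  have h : ∀ M : Matrix (Fin 4) (Fin 4) ℝ, M.det =
      M 0 0 * (M 1 1 * M 2 2 * M 3 3 - M 1 1 * M 2 3 * M 3 2 - M 1 2 * M 2 1 * M 3 3
        + M 1 2 * M 2 3 * M 3 1 + M 1 3 * M 2 1 * M 3 2 - M 1 3 * M 2 2 * M 3 1)
      - M 0 1 * (M 1 0 * M 2 2 * M 3 3 - M 1 0 * M 2 3 * M 3 2 - M 1 2 * M 2 0 * M 3 3
        + M 1 2 * M 2 3 * M 3 0 + M 1 3 * M 2 0 * M 3 2 - M 1 3 * M 2 2 * M 3 0)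
      + M 0 2 * (M 1 0 * M 2 1 * M 3 3 - M 1 0 * M 2 3 * M 3 1 - M 1 1 * M 2 0 * M 3 3
        + M 1 1 * M 2 3 * M 3 0 + M 1 3 * M 2 0 * M 3 1 - M 1 3 * M 2 1 * M 3 0)
      - M 0 3 * (M 1 0 * M 2 1 * M 3 2 - M 1 0 * M 2 2 * M 3 1 - M 1 1 * M 2 0 * M 3 2
        + M 1 1 * M 2 2 * M 3 0 + M 1 2 * M 2 0 * M 3 1 - M 1 2 * M 2 1 * M 3 0) := by
    intro M
    rw [Matrix.det_succ_row_zero]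
    simp [Fin.sum_univ_succ, Matrix.det_fin_three, Fin.succAbove]
    ring
  rw [eps4, h]
  simp only [eps4Z, minor3, dl]
  push_cast
  rfl

set_option maxRecDepth 100000 in
set_option maxHeartbeats 2000000 in
lemma eps4Z_formula : ∀ a b c d : Fin 4, 12 * eps4Z a b c d =
    (((b : ℕ) : ℤ) - (a : ℕ)) * (((c : ℕ) : ℤ) - (a : ℕ)) * (((d : ℕ) : ℤ) - (a : ℕ)) *
    (((c : ℕ) : ℤ) - (b : ℕ)) * (((d : ℕ) : ℤ) - (b : ℕ)) * (((d : ℕ) : ℤ) - (c : ℕ)) := by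
  decide

lemma eps4_formula (a b c d : Fin 4) : eps4 a b c d =
    (((b : ℕ) : ℝ) - (a : ℕ)) * (((c : ℕ) : ℝ) - (a : ℕ)) * (((d : ℕ) : ℝ) - (a : ℕ)) *
    (((c : ℕ) : ℝ) - (b : ℕ)) * (((d : ℕ) : ℝ) - (b : ℕ)) * (((d : ℕ) : ℝ) - (c : ℕ)) / 12 := by
  have h := congrArg (fun z : ℤ => (z : ℝ)) (eps4Z_formula a b c d)
  push_cast at h
  rw [eps4_eq_cast, ← h]
  ring

lemma anti_entry {A : Matrix (Fin 4) (Fin 4) ℝ} (h : Aᵀ = -A) (i j : Fin 4) :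
    A j i = - A i j := by
  have := congrFun (congrFun h i) j
  simpa using this

lemma anti_diag {A : Matrix (Fin 4) (Fin 4) ℝ} (h : Aᵀ = -A) (i : Fin 4) :
    A i i = 0 := by
  have := anti_entry h i i
  linarith

lemma wedge_formula {A B : Matrix (Fin 4) (Fin 4) ℝ} (hA : Aᵀ = -A) (hB : Bᵀ = -B) :
    (∑ μ, ∑ ν, ∑ ρ, ∑ σ, eps4 μ ν ρ σ * A μ ν * B ρ σ) = 4 * pfB A B := by
  simp only [eps4_formula, Fin.sum_univ_four, pfB]
  rw [anti_entry hA 0 1, anti_entry hA 0 2, anti_entry hA 0 3, anti_entry hA 1 2,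
    anti_entry hA 1 3, anti_entry hA 2 3, anti_entry hB 0 1, anti_entry hB 0 2,
    anti_entry hB 0 3, anti_entry hB 1 2, anti_entry hB 1 3, anti_entry hB 2 3]
  simp
  ring

lemma dual_mul {A B : Matrix (Fin 4) (Fin 4) ℝ} (hA : Aᵀ = -A) (hB : Bᵀ = -B) :
    A * dualM B + B * dualM A = (-pfB A B) • (1 : Matrix (Fin 4) (Fin 4) ℝ) := by
  ext i j
  fin_cases i <;> fin_cases j <;>
    simp [Matrix.mul_apply, Fin.sum_univ_four, dualM, pfB, anti_entry hA 0 1, anti_entry hA 0 2,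
      anti_entry hA 0 3, anti_entry hA 1 2,
      anti_entry hA 1 3, anti_entry hA 2 3, anti_entry hB 0 1, anti_entry hB 0 2,
      anti_entry hB 0 3, anti_entry hB 1 2, anti_entry hB 1 3, anti_entry hB 2 3,
      anti_diag hA, anti_diag hB] <;> ring

lemma exists_quad_ne {G : Matrix (Fin 4) (Fin 4) ℝ} (hG : Gᵀ = G) (h0 : G ≠ 0) :
    ∃ x : Fin 4 → ℝ, x ⬝ᵥ (G *ᵥ x) ≠ 0 := by
  by_contra! h
  apply h0
  ext i j
  have h1 := h (Pi.single i 1 + Pi.single j 1)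
  have h2 := h (Pi.single i 1)
  have h3 := h (Pi.single j 1)
  have hs : G j i = G i j := congrFun (congrFun hG i) j
  simp [Matrix.mulVec_add] at h1 h2 h3
  simp
  linarith

lemma exists_quad_one {G : Matrix (Fin 4) (Fin 4) ℝ} (hG : Gᵀ = G) (h0 : G ≠ 0) :
    ∃ (x : Fin 4 → ℝ) (g : ℝ), x ⬝ᵥ (G *ᵥ x) = g ∧ (g = 1 ∨ g = -1) := by
  obtain ⟨x, hx⟩ := exists_quad_ne hG h0
  set q := x ⬝ᵥ (G *ᵥ x) with hq
  have hp : 0 < |q| := abs_pos.mpr hx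
  have hs : √|q| * √|q| = |q| := Real.mul_self_sqrt hp.le
  refine ⟨(√|q|)⁻¹ • x, q / |q|, ?_, ?_⟩
  · simp only [Matrix.mulVec_smul, smul_dotProduct, dotProduct_smul, ← hq, smul_eq_mul]
    rw [← mul_assoc, ← mul_inv, hs]
    ring
  · rcases lt_or_gt_of_ne hx with h | h
    · right; rw [abs_of_neg h]; field_simp
    · left; rw [abs_of_pos h]; field_simp

lemma quad_anti {A : Matrix (Fin 4) (Fin 4) ℝ} (hA : Aᵀ = -A) (x : Fin 4 → ℝ) :
    x ⬝ᵥ (A *ᵥ x) = 0 := by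
  have h : x ⬝ᵥ (A *ᵥ x) = x ⬝ᵥ (Aᵀ *ᵥ x) := by
    rw [Matrix.mulVec_transpose, Matrix.dotProduct_mulVec, dotProduct_comm]
  rw [hA, Matrix.neg_mulVec, dotProduct_neg] at h
  linarith

/-- Algebraic core: canonical form from quaternionic relations. -/
lemma core (A I J : Matrix (Fin 4) (Fin 4) ℝ) (hA : Aᵀ = -A) (hdA : A ≠ 0)
    (hI : I * I = -1) (hJ : J * J = -1) (hIJ : J * I = -(I * J))
    (hIA : Iᵀ * A = A * I) (hJA : Jᵀ * A = A * J) :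
    ∃ (P : Matrix (Fin 4) (Fin 4) ℝ) (s : ℝ), (s = 1 ∨ s = -1) ∧
      Pᵀ * A * P = Scan 0 ∧ Pᵀ * (A * I) * P = Scan 1 ∧
      Pᵀ * (A * J) * P = s • Scan 2 := by
  have hI' : ∀ Z, I * (I * Z) = -Z := fun Z => by rw [← mul_assoc, hI]; simp
  have hJ' : ∀ Z, J * (J * Z) = -Z := fun Z => by rw [← mul_assoc, hJ]; simp
  have hIJ' : ∀ Z, J * (I * Z) = -(I * (J * Z)) := fun Z => by
    rw [← mul_assoc, hIJ]; simp [mul_assoc]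
  have hAI : (A * I)ᵀ = -(A * I) := by
    rw [Matrix.transpose_mul, hA, mul_neg, hIA]
  have hAJ : (A * J)ᵀ = -(A * J) := by
    rw [Matrix.transpose_mul, hA, mul_neg, hJA]
  have hKA : (I * J)ᵀ * A = -(A * (I * J)) := by
    rw [Matrix.transpose_mul, mul_assoc, hIA, ← mul_assoc, hJA, mul_assoc, hIJ, mul_neg]
  have hG : (A * (I * J))ᵀ = A * (I * J) := by
    rw [Matrix.transpose_mul, hA, mul_neg, hKA, neg_neg]
  have hG0 : A * (I * J) ≠ 0 := by
    intro h
    apply hdA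
    have : A * (I * J) * (J * I) = A := by
      simp [mul_assoc, hJ', hI]
    rw [← this, h, zero_mul]
  obtain ⟨x, g, hx, hg⟩ := exists_quad_one hG hG0
  have q0 := quad_anti hA x
  have q1 := quad_anti hAI x
  have q2 := quad_anti hAJ x
  have hg2 : g * g = 1 := by rcases hg with h | h <;> simp [h]
  set M : Fin 4 → Matrix (Fin 4) (Fin 4) ℝ := ![1, -I, g • J, -(g • (I * J))] with hM
  set N : Fin 4 → Matrix (Fin 4) (Fin 4) ℝ := ![1, -I, g • J, g • (I * J)] with hN
  have hMN : ∀ i, (M i)ᵀ * A = A * N i := by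
    intro i
    fin_cases i <;> simp [hM, hN, hIA, hJA]
    rw [← Matrix.transpose_mul, hKA]; simp
  have key : ∀ (Z : Matrix (Fin 4) (Fin 4) ℝ) (i j : Fin 4),
      ((Matrix.of fun a b => (M b *ᵥ x) a)ᵀ * (A * Z) * (Matrix.of fun a b => (M b *ᵥ x) a)) i j
        = x ⬝ᵥ ((A * (N i * Z * M j)) *ᵥ x) := by
    intro Z i j
    have : A * (N i * Z * M j) = (M i)ᵀ * ((A * Z) * M j) := by
      simp only [← mul_assoc, hMN]
    rw [this, ← Matrix.mulVec_mulVec, Matrix.dotProduct_mulVec, Matrix.vecMul_transpose,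
      ← Matrix.mulVec_mulVec, Matrix.dotProduct_mulVec]
    rfl
  refine ⟨Matrix.of fun a b => (M b *ᵥ x) a, -g, ?_, ?_, ?_, ?_⟩
  · rcases hg with h | h <;> simp [h]
  · ext i j
    have := key 1 i j
    rw [mul_one] at this
    rw [this]
    fin_cases i <;> fin_cases j <;>
      simp [hM, hN, Scan, mul_assoc, hI, hJ, hIJ, hI', hIJ', q0, q1, q2, hx, hg2,
        Matrix.neg_mulVec, Matrix.smul_mulVec]
  · ext i j
    rw [key]
    fin_cases i <;> fin_cases j <;>
      simp [hM, hN, Scan, mul_assoc, hI, hJ, hIJ, hI', hIJ', q0, q1, q2, hx, hg2,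
        Matrix.neg_mulVec, Matrix.smul_mulVec]
  · ext i j
    rw [key]
    fin_cases i <;> fin_cases j <;>
      simp [hM, hN, Scan, mul_assoc, hI, hJ, hIJ, hI', hIJ', q0, q1, q2, hx, hg2,
        Matrix.neg_mulVec, Matrix.smul_mulVec]

/-- without the orientation condition, a triple of antisymmetric
4×4 matrices with `Σⁱ ∧ Σʲ = 2δ^{ij} vol` (`vol` nowhere vanishing) can be
brought to the canonical form up to a sign on `Σ³`. -/
theorem su2_structure_canonical_form_up_to_sign
    (Sig : Fin 3 → Matrix (Fin 4) (Fin 4) ℝ)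
    (hanti : ∀ i, (Sig i)ᵀ = -Sig i)
    (v : ℝ) (hv : v ≠ 0)
    (hwedge : ∀ i j, (∑ μ, ∑ ν, ∑ ρ, ∑ σ, eps4 μ ν ρ σ * Sig i μ ν * Sig j ρ σ)
      = 8 * v * (if i = j then 1 else 0)) :
    ∃ (P : Matrix (Fin 4) (Fin 4) ℝ) (s : ℝ), IsUnit P.det ∧ (s = 1 ∨ s = -1) ∧
      Pᵀ * Sig 0 * P = Scan 0 ∧ Pᵀ * Sig 1 * P = Scan 1 ∧
      Pᵀ * Sig 2 * P = s • Scan 2 := by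
  set D : Fin 3 → Matrix (Fin 4) (Fin 4) ℝ := fun i => (-v)⁻¹ • dualM (Sig i) with hD
  have hpf : ∀ i j, pfB (Sig i) (Sig j) = 2 * v * (if i = j then 1 else 0) := by
    intro i j
    have := hwedge i j
    rw [wedge_formula (hanti i) (hanti j)] at this
    linarith
  have hdiag : ∀ i, Sig i * D i = 1 := by
    intro i
    have h := dual_mul (hanti i) (hanti i)
    rw [hpf, if_pos rfl, ← two_smul ℝ (Sig i * dualM (Sig i))] at h
    have h2 : Sig i * dualM (Sig i) = (-v) • (1 : Matrix (Fin 4) (Fin 4) ℝ) := by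
      have := congrArg (fun Z => (2 : ℝ)⁻¹ • Z) h
      simp only [smul_smul] at this
      rw [inv_mul_cancel₀ two_ne_zero, one_smul] at this
      rw [this]; congr 1; ring
    rw [hD]
    simp only [Matrix.mul_smul, h2, smul_smul]
    rw [inv_mul_cancel₀ (neg_ne_zero.mpr hv), one_smul]
  have hdiag' : ∀ i, D i * Sig i = 1 := fun i => mul_eq_one_comm.mp (hdiag i)
  have hoff : ∀ i j, i ≠ j → Sig i * D j = -(Sig j * D i) := by
    intro i j hij
    have h := dual_mul (hanti i) (hanti j)
    rw [hpf, if_neg hij, mul_zero, neg_zero, zero_smul] at h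
    rw [hD]
    simp only [Matrix.mul_smul]
    rw [eq_neg_of_add_eq_zero_left h, smul_neg]
  have hoff' : ∀ i j, i ≠ j → D i * Sig j = -(D j * Sig i) := by
    intro i j hij
    calc D i * Sig j = D i * (Sig j * D i) * Sig i := by
          simp [mul_assoc, hdiag']
      _ = -(D j * Sig i) := by
          rw [hoff j i hij.symm, mul_neg, ← mul_assoc, hdiag', one_mul, neg_mul]
  have hAz : ∀ i, Sig 0 * (D 0 * Sig i) = Sig i := fun i => by
    rw [← mul_assoc, hdiag, one_mul]
  have hprod : ∀ i j, i ≠ 0 → D 0 * Sig i * (D 0 * Sig j) = -(D i * Sig j) := by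
    intro i j hi
    rw [hoff' 0 i hi.symm, neg_mul, mul_assoc, hAz]
  have hsq : ∀ i, i ≠ 0 → D 0 * Sig i * (D 0 * Sig i) = -1 := by
    intro i hi
    rw [hprod i i hi, hdiag']
  have htr : ∀ i, (D 0 * Sig i)ᵀ * Sig 0 = Sig 0 * (D 0 * Sig i) := by
    intro i
    have h : (Sig 0 * (D 0 * Sig i))ᵀ = -(Sig i) := by rw [hAz, hanti]
    rw [Matrix.transpose_mul, hanti, mul_neg] at h
    rw [neg_injective h, hAz]
  have hA0 : Sig 0 ≠ 0 := by
    intro h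
    have := hdiag 0
    rw [h, zero_mul] at this
    exact zero_ne_one this
  obtain ⟨P, s, hs, h0, h1, h2⟩ := core (Sig 0) (D 0 * Sig 1) (D 0 * Sig 2) (hanti 0) hA0
    (hsq 1 (by decide)) (hsq 2 (by decide))
    (by rw [hprod 2 1 (by decide), hprod 1 2 (by decide), hoff' 2 1 (by decide)])
    (htr 1) (htr 2)
  rw [hAz] at h1 h2
  refine ⟨P, s, ?_, hs, h0, h1, h2⟩
  rw [isUnit_iff_ne_zero]
  intro hP
  have := congrArg Matrix.det h0
  rw [Matrix.det_mul, hP, mul_zero] at this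
  simp [Scan, Matrix.det_succ_row_zero, Fin.sum_univ_succ, Fin.succAbove] at this
end

section
/- Let T be the 18-dimensional space of triples of antisymmetric real 4×4 matrices and J₂ : T → T the operator J₂(B)ⁱ := (1/2) ∑_{j,k} ε^{ijk} (Sʲ Bᵏ − Bᵏ Sʲ). Then T decomposes as the internal direct sum T = ker(J₂ − 2·id) ⊕ ker(J₂ − id) ⊕ ker(J₂) ⊕ ker(J₂ + id), where: ker(J₂ − 2·id) = { (λS¹, λS², λS³) : λ ∈ ℝ } has dimension 1; ker(J₂ − id) = { B : Bⁱ = ∑_j M^{ij} Sʲ, M ∈ M₃(ℝ) antisymmetric } has dimension 3; ker(J₂ + id) = { B : Bⁱ = ∑_j M^{ij} Sʲ, M ∈ M₃(ℝ) symmetric with tr(M) = 0 } has dimension 5; and ker(J₂) = { B : Bⁱ = (1/2)(h Sⁱ + Sⁱ h), h ∈ M₄(ℝ) symmetric with tr(h) = 0 } has dimension 9. -/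
open Matrix BigOperators

/-- Levi-Civita symbol on three indices, `ε 0 1 2 = 1`. -/
noncomputable def eps3 (i j k : Fin 3) : ℝ :=
  Matrix.det (Matrix.of fun a b => if ![i, j, k] a = b then (1 : ℝ) else 0)

/-- The operator `J₂(B)ⁱ = (1/2) ∑_{jk} ε^{ijk} (Sʲ Bᵏ − Bᵏ Sʲ)` as a linear map. -/
noncomputable def J2lin :
    (Fin 3 → Matrix (Fin 4) (Fin 4) ℝ) →ₗ[ℝ] (Fin 3 → Matrix (Fin 4) (Fin 4) ℝ) where
  toFun B := fun i => (1 / 2 : ℝ) • ∑ j, ∑ k, eps3 i j k • (Scan j * B k - B k * Scan j)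
  map_add' B C := by
    funext i
    simp only [Pi.add_apply, Matrix.mul_add, Matrix.add_mul, ← smul_add, ← Finset.sum_add_distrib]
    congr 1
    apply Finset.sum_congr rfl; intro j _
    apply Finset.sum_congr rfl; intro k _
    congr 1
    abel
  map_smul' c B := by
    funext i
    simp only [Pi.smul_apply, Matrix.mul_smul, Matrix.smul_mul, RingHom.id_apply, ← smul_sub,
      Finset.smul_sum, smul_comm c]

/-- The 18-dimensional space `T` of triples of antisymmetric real 4×4 matrices,
as a submodule of all triples of matrices. -/
def Tsub : Submodule ℝ (Fin 3 → Matrix (Fin 4) (Fin 4) ℝ) where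
  carrier := {B | ∀ i, (B i)ᵀ = -B i}
  add_mem' := by
    intro a b ha hb i
    simp only [Pi.add_apply, Matrix.transpose_add, ha i, hb i, Pi.neg_apply]
    abel
  zero_mem' := by intro i; simp
  smul_mem' := by
    intro c a ha i
    simp [Matrix.transpose_smul, ha i]

/-- The anti-self-dual partners of `Scan`. -/
def Acan : Fin 3 → Matrix (Fin 4) (Fin 4) ℝ :=
  ![!![0, 0, 0, -1; 0, 0, 1, 0; 0, -1, 0, 0; 1, 0, 0, 0],
    !![0, 0, -1, 0; 0, 0, 0, -1; 1, 0, 0, 0; 0, 1, 0, 0],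
    !![0, 1, 0, 0; -1, 0, 0, 0; 0, 0, 0, -1; 0, 0, 1, 0]]

/-- Coordinates `(M, N)` to triples of matrices. -/
def PQ : (Matrix (Fin 3) (Fin 3) ℝ × Matrix (Fin 3) (Fin 3) ℝ) →ₗ[ℝ]
    (Fin 3 → Matrix (Fin 4) (Fin 4) ℝ) where
  toFun X := fun i => ∑ j, X.1 i j • Scan j + ∑ j, X.2 i j • Acan j
  map_add' X Y := by
    funext i
    simp only [Prod.fst_add, Prod.snd_add, Matrix.add_apply, add_smul, Finset.sum_add_distrib,
      Pi.add_apply]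
    abel
  map_smul' c X := by
    funext i
    simp only [Prod.smul_fst, Prod.smul_snd, Matrix.smul_apply, Pi.smul_apply, smul_add,
      Finset.smul_sum, smul_smul, RingHom.id_apply, smul_eq_mul]

theorem PQ_apply (X) (i : Fin 3) :
    PQ X i = ∑ j, X.1 i j • Scan j + ∑ j, X.2 i j • Acan j := rfl

theorem PQ_entries (X) (i : Fin 3) : PQ X i =
    !![0, -X.1 i 2 + X.2 i 2, X.1 i 1 - X.2 i 1, -X.1 i 0 - X.2 i 0;
       X.1 i 2 - X.2 i 2, 0, -X.1 i 0 + X.2 i 0, -X.1 i 1 - X.2 i 1;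
       -X.1 i 1 + X.2 i 1, X.1 i 0 - X.2 i 0, 0, -X.1 i 2 - X.2 i 2;
       X.1 i 0 + X.2 i 0, X.1 i 1 + X.2 i 1, X.1 i 2 + X.2 i 2, 0] := by
  ext a b
  rw [PQ_apply]
  fin_cases a <;> fin_cases b <;> simp [Fin.sum_univ_three, Scan, Acan] <;> ring

theorem PQ_inj : Function.Injective PQ := by
  intro X Y h
  have h' : ∀ i a b, PQ X i a b = PQ Y i a b := by rw [h]; simp
  simp only [PQ_entries] at h'
  have e : ∀ i j, X.1 i j = Y.1 i j ∧ X.2 i j = Y.2 i j := by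
    intro i j
    have h1 := h' i 3 0
    have h2 := h' i 3 1
    have h3 := h' i 3 2
    have h4 := h' i 2 1
    have h5 := h' i 0 2
    have h6 := h' i 1 0
    simp at h1 h2 h3 h4 h5 h6
    fin_cases j <;> constructor <;> simp <;> linarith
  refine Prod.ext ?_ ?_
  · ext i j; exact (e i j).1
  · ext i j; exact (e i j).2

theorem PQ_mem (X) : PQ X ∈ Tsub := by
  intro i
  rw [PQ_entries]
  ext a b
  fin_cases a <;> fin_cases b <;> simp <;> ring

theorem PQ_surj {B} (hB : B ∈ Tsub) : ∃ X, PQ X = B := by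
  have h' : ∀ i a b, B i b a = - B i a b := by
    intro i a b
    have := congrFun (congrFun (hB i) a) b
    simpa using this
  refine ⟨(Matrix.of fun i j => ![(B i 3 0 + B i 2 1) / 2, (B i 3 1 + B i 0 2) / 2,
      (B i 3 2 + B i 1 0) / 2] j, Matrix.of fun i j => ![(B i 3 0 - B i 2 1) / 2,
      (B i 3 1 - B i 0 2) / 2, (B i 3 2 - B i 1 0) / 2] j), ?_⟩
  funext i
  rw [PQ_entries]
  have d0 := h' i 0 0
  have d1 := h' i 1 1
  have d2 := h' i 2 2
  have d3 := h' i 3 3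
  have d4 := h' i 0 1
  have d5 := h' i 0 2
  have d6 := h' i 0 3
  have d7 := h' i 1 2
  have d8 := h' i 1 3
  have d9 := h' i 2 3
  ext a b
  fin_cases a <;> fin_cases b <;> simp <;> linarith

theorem J2_apply (B) : J2lin B = ![
    (1 / 2 : ℝ) • ((Scan 1 * B 2 - B 2 * Scan 1) - (Scan 2 * B 1 - B 1 * Scan 2)),
    (1 / 2 : ℝ) • ((Scan 2 * B 0 - B 0 * Scan 2) - (Scan 0 * B 2 - B 2 * Scan 0)),
    (1 / 2 : ℝ) • ((Scan 0 * B 1 - B 1 * Scan 0) - (Scan 1 * B 0 - B 0 * Scan 1))] := by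
  funext i
  change (1 / 2 : ℝ) • ∑ j, ∑ k, eps3 i j k • (Scan j * B k - B k * Scan j) = _
  fin_cases i <;> simp [Fin.sum_univ_three, eps3, Matrix.det_fin_three, smul_add, smul_sub] <;> abel

theorem comm_S0 (X) (k : Fin 3) : Scan 0 * PQ X k - PQ X k * Scan 0 =
    (2 : ℝ) • PQ (Matrix.of fun _ => ![0, -X.1 k 2, X.1 k 1], 0) 0 := by
  rw [PQ_entries, PQ_entries]
  ext a b
  fin_cases a <;> fin_cases b <;> simp [Scan] <;> ring

theorem comm_S1 (X) (k : Fin 3) : Scan 1 * PQ X k - PQ X k * Scan 1 =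
    (2 : ℝ) • PQ (Matrix.of fun _ => ![X.1 k 2, 0, -X.1 k 0], 0) 0 := by
  rw [PQ_entries, PQ_entries]
  ext a b
  fin_cases a <;> fin_cases b <;> simp [Scan] <;> ring

theorem comm_S2 (X) (k : Fin 3) : Scan 2 * PQ X k - PQ X k * Scan 2 =
    (2 : ℝ) • PQ (Matrix.of fun _ => ![-X.1 k 1, X.1 k 0, 0], 0) 0 := by
  rw [PQ_entries, PQ_entries]
  ext a b
  fin_cases a <;> fin_cases b <;> simp [Scan] <;> ring

theorem J2_PQ (X) : J2lin (PQ X) = PQ (X.1.trace • 1 - X.1ᵀ, 0) := by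
  rw [J2_apply]
  simp only [comm_S0, comm_S1, comm_S2, ← smul_sub, smul_smul]
  funext i
  fin_cases i <;>
    simp [PQ_apply, Fin.sum_univ_three, Matrix.trace, ← sub_smul, ← add_smul] <;> module

theorem mem2 (X) : PQ X ∈ LinearMap.ker (J2lin - (2 : ℝ) • LinearMap.id) ⊓ Tsub ↔
    X.1 = X.1 0 0 • 1 ∧ X.2 = 0 := by
  have : PQ X ∈ LinearMap.ker (J2lin - (2 : ℝ) • LinearMap.id) ⊓ Tsub ↔
      (X.1.trace • 1 - X.1ᵀ, (0 : Matrix (Fin 3) (Fin 3) ℝ)) = (2 : ℝ) • X := by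
    simp only [Submodule.mem_inf, PQ_mem, and_true, LinearMap.mem_ker, LinearMap.sub_apply,
      LinearMap.smul_apply, LinearMap.id_apply, J2_PQ, sub_eq_zero, ← map_smul]
    exact PQ_inj.eq_iff
  rw [this, Prod.ext_iff]
  obtain ⟨M, N⟩ := X
  simp [← Matrix.ext_iff, Fin.forall_fin_succ, Matrix.trace, Fin.sum_univ_three, Matrix.one_apply]
  grind

theorem mem1 (X) : PQ X ∈ LinearMap.ker (J2lin - LinearMap.id) ⊓ Tsub ↔
    X.1ᵀ = - X.1 ∧ X.2 = 0 := by
  have : PQ X ∈ LinearMap.ker (J2lin - LinearMap.id) ⊓ Tsub ↔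
      (X.1.trace • 1 - X.1ᵀ, (0 : Matrix (Fin 3) (Fin 3) ℝ)) = X := by
    simp only [Submodule.mem_inf, PQ_mem, and_true, LinearMap.mem_ker, LinearMap.sub_apply,
      LinearMap.id_apply, J2_PQ, sub_eq_zero]
    exact PQ_inj.eq_iff
  rw [this, Prod.ext_iff]
  obtain ⟨M, N⟩ := X
  simp [← Matrix.ext_iff, Fin.forall_fin_succ, Matrix.trace, Fin.sum_univ_three, Matrix.one_apply]
  grind

theorem memn (X) : PQ X ∈ LinearMap.ker (J2lin + LinearMap.id) ⊓ Tsub ↔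
    X.1ᵀ = X.1 ∧ X.1.trace = 0 ∧ X.2 = 0 := by
  have : PQ X ∈ LinearMap.ker (J2lin + LinearMap.id) ⊓ Tsub ↔
      (X.1.trace • 1 - X.1ᵀ, (0 : Matrix (Fin 3) (Fin 3) ℝ)) = -X := by
    simp only [Submodule.mem_inf, PQ_mem, and_true, LinearMap.mem_ker, LinearMap.add_apply,
      LinearMap.id_apply, J2_PQ, add_eq_zero_iff_eq_neg, ← map_neg]
    exact PQ_inj.eq_iff
  rw [this, Prod.ext_iff]
  obtain ⟨M, N⟩ := X
  simp [← Matrix.ext_iff, Fin.forall_fin_succ, Matrix.trace, Fin.sum_univ_three, Matrix.one_apply]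
  grind

theorem mem0 (X) : PQ X ∈ LinearMap.ker J2lin ⊓ Tsub ↔ X.1 = 0 := by
  have : PQ X ∈ LinearMap.ker J2lin ⊓ Tsub ↔
      (X.1.trace • 1 - X.1ᵀ, (0 : Matrix (Fin 3) (Fin 3) ℝ)) = 0 := by
    simp only [Submodule.mem_inf, PQ_mem, and_true, LinearMap.mem_ker, J2_PQ]
    rw [← map_zero PQ]
    exact PQ_inj.eq_iff
  rw [this, Prod.ext_iff]
  obtain ⟨M, N⟩ := X
  simp [← Matrix.ext_iff, Fin.forall_fin_succ, Matrix.trace, Fin.sum_univ_three, Matrix.one_apply]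
  grind

/-- Dimension count through an injective parametrization. -/
theorem finrank_param {V : Submodule ℝ (Fin 3 → Matrix (Fin 4) (Fin 4) ℝ)} {E : Type*}
    [AddCommGroup E] [Module ℝ E] (hV : V ≤ Tsub)
    (f : E →ₗ[ℝ] (Matrix (Fin 3) (Fin 3) ℝ × Matrix (Fin 3) (Fin 3) ℝ))
    (hf : Function.Injective f) (h : ∀ X, PQ X ∈ V ↔ ∃ v, f v = X) :
    Module.finrank ℝ V = Module.finrank ℝ E := by
  have : V = LinearMap.range (PQ ∘ₗ f) := by
    ext B
    constructor
    · intro hB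
      obtain ⟨X, rfl⟩ := PQ_surj (hV hB)
      obtain ⟨v, rfl⟩ := (h X).1 hB
      exact ⟨v, rfl⟩
    · rintro ⟨v, rfl⟩
      exact (h _).2 ⟨v, rfl⟩
  rw [this]
  exact LinearMap.finrank_range_of_inj (PQ_inj.comp hf)

/-- Parametrization of multiples of the identity. -/
def f2 : ℝ →ₗ[ℝ] (Matrix (Fin 3) (Fin 3) ℝ × Matrix (Fin 3) (Fin 3) ℝ) where
  toFun c := (c • 1, 0)
  map_add' a b := by simp [add_smul]
  map_smul' a b := by simp [mul_smul]

/-- Parametrization of antisymmetric matrices. -/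
def f1 : (Fin 3 → ℝ) →ₗ[ℝ] (Matrix (Fin 3) (Fin 3) ℝ × Matrix (Fin 3) (Fin 3) ℝ) where
  toFun c := (!![0, c 0, c 1; -c 0, 0, c 2; -c 1, -c 2, 0], 0)
  map_add' a b := by
    refine Prod.ext ?_ (by simp)
    ext i j; fin_cases i <;> fin_cases j <;> simp <;> ring
  map_smul' a b := by
    refine Prod.ext ?_ (by simp)
    ext i j; fin_cases i <;> fin_cases j <;> simp

/-- Parametrization of symmetric traceless matrices. -/
def fn : (Fin 5 → ℝ) →ₗ[ℝ] (Matrix (Fin 3) (Fin 3) ℝ × Matrix (Fin 3) (Fin 3) ℝ) where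
  toFun c := (!![c 3, c 0, c 1; c 0, c 4, c 2; c 1, c 2, -c 3 - c 4], 0)
  map_add' a b := by
    refine Prod.ext ?_ (by simp)
    ext i j; fin_cases i <;> fin_cases j <;> simp <;> ring
  map_smul' a b := by
    refine Prod.ext ?_ (by simp)
    ext i j; fin_cases i <;> fin_cases j <;> simp <;> ring

theorem le_sup_aux (M N : Matrix (Fin 3) (Fin 3) ℝ) :
    PQ (M, N) = PQ ((M.trace / 3) • 1, 0) + PQ ((1 / 2 : ℝ) • (M - Mᵀ), 0) + PQ (0, N)
      + PQ ((1 / 2 : ℝ) • (M + Mᵀ) - (M.trace / 3) • 1, 0) := by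
  simp only [← map_add]
  congr 1
  refine Prod.ext ?_ (by simp)
  ext i j
  simp
  ring

theorem PQ_left (M) : PQ (M, 0) = fun i => ∑ j, M i j • Scan j := by
  funext i
  simp [PQ_apply]

set_option maxHeartbeats 4000000 in
/-- The coordinates of `(h S + S h)/2`. -/
theorem hS_eq (h : Matrix (Fin 4) (Fin 4) ℝ) (hs : hᵀ = h) (ht : h.trace = 0) :
    (fun i => (1 / 2 : ℝ) • (h * Scan i + Scan i * h)) = PQ (0,
      !![(h 0 0 + h 3 3) / 2, (h 0 1 + h 2 3) / 2, (h 0 2 - h 1 3) / 2;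
         (h 0 1 - h 2 3) / 2, (h 1 1 + h 3 3) / 2, (h 1 2 + h 0 3) / 2;
         (h 0 2 + h 1 3) / 2, (h 1 2 - h 0 3) / 2, (h 2 2 + h 3 3) / 2]) := by
  have s : ∀ a b, h a b = h b a := by
    intro a b
    exact (congrFun (congrFun hs b) a)
  simp [Matrix.trace, Fin.sum_univ_four] at ht
  have t1 := s 1 0
  have t2 := s 2 0
  have t3 := s 3 0
  have t4 := s 2 1
  have t5 := s 3 1
  have t6 := s 3 2
  funext i
  rw [PQ_entries]
  ext a b
  fin_cases i <;> fin_cases a <;> fin_cases b <;>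
    simp [Scan, Matrix.mul_apply, Matrix.vecMul, dotProduct, Fin.sum_univ_four] <;> linarith

/-- the eigenspace decomposition
`T = ker(J₂−2) ⊕ ker(J₂−1) ⊕ ker(J₂) ⊕ ker(J₂+1)` with the indicated
descriptions and dimensions 1, 3, 9, 5. -/
theorem J2_eigenspace_decomposition :
    (∀ B, B ∈ LinearMap.ker (J2lin - (2 : ℝ) • LinearMap.id) ⊓ Tsub ↔
      ∃ lam : ℝ, ∀ i, B i = lam • Scan i) ∧
    Module.finrank ℝ ↥(LinearMap.ker (J2lin - (2 : ℝ) • LinearMap.id) ⊓ Tsub) = 1 ∧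
    (∀ B, B ∈ LinearMap.ker (J2lin - LinearMap.id) ⊓ Tsub ↔
      ∃ M : Matrix (Fin 3) (Fin 3) ℝ, Mᵀ = -M ∧ ∀ i, B i = ∑ j, M i j • Scan j) ∧
    Module.finrank ℝ ↥(LinearMap.ker (J2lin - LinearMap.id) ⊓ Tsub) = 3 ∧
    (∀ B, B ∈ LinearMap.ker (J2lin + LinearMap.id) ⊓ Tsub ↔
      ∃ M : Matrix (Fin 3) (Fin 3) ℝ, Mᵀ = M ∧ M.trace = 0 ∧
        ∀ i, B i = ∑ j, M i j • Scan j) ∧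
    Module.finrank ℝ ↥(LinearMap.ker (J2lin + LinearMap.id) ⊓ Tsub) = 5 ∧
    (∀ B, B ∈ LinearMap.ker J2lin ⊓ Tsub ↔
      ∃ h : Matrix (Fin 4) (Fin 4) ℝ, hᵀ = h ∧ h.trace = 0 ∧
        ∀ i, B i = (1 / 2 : ℝ) • (h * Scan i + Scan i * h)) ∧
    Module.finrank ℝ ↥(LinearMap.ker J2lin ⊓ Tsub) = 9 ∧
    Module.finrank ℝ Tsub = 18 ∧
    (LinearMap.ker (J2lin - (2 : ℝ) • LinearMap.id) ⊓ Tsub)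
      ⊔ (LinearMap.ker (J2lin - LinearMap.id) ⊓ Tsub)
      ⊔ (LinearMap.ker J2lin ⊓ Tsub)
      ⊔ (LinearMap.ker (J2lin + LinearMap.id) ⊓ Tsub) = Tsub := by
  have l2 : LinearMap.ker (J2lin - (2 : ℝ) • LinearMap.id) ⊓ Tsub ≤ Tsub := inf_le_right
  have l1 : LinearMap.ker (J2lin - LinearMap.id) ⊓ Tsub ≤ Tsub := inf_le_right
  have ln : LinearMap.ker (J2lin + LinearMap.id) ⊓ Tsub ≤ Tsub := inf_le_right
  have l0 : LinearMap.ker J2lin ⊓ Tsub ≤ Tsub := inf_le_right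
  refine ⟨?_, ?_, ?_, ?_, ?_, ?_, ?_, ?_, ?_, ?_⟩
  · intro B
    constructor
    · intro hB
      obtain ⟨⟨M, N⟩, rfl⟩ := PQ_surj (l2 hB)
      obtain ⟨h1, h2⟩ := (mem2 _).1 hB
      simp only at h1 h2
      subst h2
      refine ⟨M 0 0, fun i => ?_⟩
      rw [PQ_left, h1]
      simp [Matrix.one_apply]
    · rintro ⟨c, hc⟩
      have : B = PQ (c • 1, 0) := by
        rw [PQ_left]; funext i; rw [hc]; simp [Matrix.one_apply]
      rw [this, mem2]
      simp
  · rw [finrank_param l2 f2]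
    · simp
    · intro a b h
      have := congrFun (congrFun (congrArg Prod.fst h) 0) 0
      simpa [f2] using this
    · rintro ⟨M, N⟩
      rw [mem2]
      constructor
      · rintro ⟨h1, h2⟩
        exact ⟨M 0 0, Prod.ext h1.symm h2.symm⟩
      · rintro ⟨v, hv⟩
        obtain ⟨rfl, rfl⟩ := Prod.ext_iff.1 hv
        simp [f2]
  · intro B
    constructor
    · intro hB
      obtain ⟨⟨M, N⟩, rfl⟩ := PQ_surj (l1 hB)
      obtain ⟨h1, h2⟩ := (mem1 _).1 hB
      simp only at h1 h2
      subst h2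
      exact ⟨M, h1, fun i => by rw [PQ_left]⟩
    · rintro ⟨M, hM, hc⟩
      have : B = PQ (M, 0) := by
        rw [PQ_left]; funext i; rw [hc]
      rw [this, mem1]
      exact ⟨hM, rfl⟩
  · rw [finrank_param l1 f1]
    · simp
    · intro a b h
      have h0 := congrFun (congrFun (congrArg Prod.fst h) 0) 1
      have h1 := congrFun (congrFun (congrArg Prod.fst h) 0) 2
      have h2 := congrFun (congrFun (congrArg Prod.fst h) 1) 2
      simp [f1] at h0 h1 h2
      funext i
      fin_cases i <;> simpa
    · rintro ⟨M, N⟩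
      rw [mem1]
      constructor
      · rintro ⟨h1, h2⟩
        refine ⟨![M 0 1, M 0 2, M 1 2], Prod.ext ?_ h2.symm⟩
        have e : ∀ i j, M j i = - M i j := fun i j => congrFun (congrFun h1 i) j
        have e0 := e 0 0
        have e1 := e 1 1
        have e2 := e 2 2
        have e3 := e 0 1
        have e4 := e 0 2
        have e5 := e 1 2
        ext i j
        fin_cases i <;> fin_cases j <;> simp [f1] <;> linarith
      · rintro ⟨v, hv⟩
        rw [← hv]
        refine ⟨?_, rfl⟩
        ext i j
        fin_cases i <;> fin_cases j <;> simp [f1]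
  · intro B
    constructor
    · intro hB
      obtain ⟨⟨M, N⟩, rfl⟩ := PQ_surj (ln hB)
      obtain ⟨h1, h3, h2⟩ := (memn _).1 hB
      simp only at h1 h2 h3
      subst h2
      exact ⟨M, h1, h3, fun i => by rw [PQ_left]⟩
    · rintro ⟨M, hM, hT, hc⟩
      have : B = PQ (M, 0) := by
        rw [PQ_left]; funext i; rw [hc]
      rw [this, memn]
      exact ⟨hM, hT, rfl⟩
  · rw [finrank_param ln fn]
    · simp
    · intro a b h
      have h0 := congrFun (congrFun (congrArg Prod.fst h) 0) 1
      have h1 := congrFun (congrFun (congrArg Prod.fst h) 0) 2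
      have h2 := congrFun (congrFun (congrArg Prod.fst h) 1) 2
      have h3 := congrFun (congrFun (congrArg Prod.fst h) 0) 0
      have h4 := congrFun (congrFun (congrArg Prod.fst h) 1) 1
      simp [fn] at h0 h1 h2 h3 h4
      funext i
      fin_cases i <;> simpa
    · rintro ⟨M, N⟩
      rw [memn]
      constructor
      · rintro ⟨h1, h3, h2⟩
        refine ⟨![M 0 1, M 0 2, M 1 2, M 0 0, M 1 1], Prod.ext ?_ h2.symm⟩
        have e : ∀ i j, M j i = M i j := fun i j => congrFun (congrFun h1 i) j
        have e3 := e 0 1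
        have e4 := e 0 2
        have e5 := e 1 2
        simp [Matrix.trace, Fin.sum_univ_three] at h3
        ext i j
        fin_cases i <;> fin_cases j <;> simp [fn] <;> linarith
      · rintro ⟨v, hv⟩
        rw [← hv]
        refine ⟨?_, ?_, rfl⟩
        · ext i j
          fin_cases i <;> fin_cases j <;> simp [fn]
        · simp [fn, Matrix.trace, Fin.sum_univ_three]
  · intro B
    constructor
    · intro hB
      obtain ⟨⟨M, N⟩, rfl⟩ := PQ_surj (l0 hB)
      have h1 := (mem0 _).1 hB
      simp only at h1
      subst h1
      let h : Matrix (Fin 4) (Fin 4) ℝ :=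
        !![(N 0 0 - N 1 1 - N 2 2), (N 0 1 + N 1 0), (N 0 2 + N 2 0),
            (N 1 2 - N 2 1);
          (N 0 1 + N 1 0), (N 1 1 - N 0 0 - N 2 2), (N 1 2 + N 2 1),
            (N 2 0 - N 0 2);
          (N 0 2 + N 2 0), (N 1 2 + N 2 1), (N 2 2 - N 0 0 - N 1 1),
            (N 0 1 - N 1 0);
          (N 1 2 - N 2 1), (N 2 0 - N 0 2), (N 0 1 - N 1 0),
            (N 0 0 + N 1 1 + N 2 2)]
      have hs : hᵀ = h := by
        ext i j
        fin_cases i <;> fin_cases j <;> simp [h]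
      have ht : h.trace = 0 := by
        simp [h, Matrix.trace, Fin.sum_univ_four]
        ring
      refine ⟨h, hs, ht, fun i => ?_⟩
      have key := congrFun (hS_eq h hs ht) i
      refine Eq.trans ?_ key.symm
      refine congrFun (congrArg (fun K => PQ (0, K)) ?_) i
      ext i j
      fin_cases i <;> fin_cases j <;> simp [h] <;> ring
    · rintro ⟨h, hs, ht, hc⟩
      have : B = fun i => (1 / 2 : ℝ) • (h * Scan i + Scan i * h) := funext hc
      rw [this, hS_eq h hs ht, mem0]
  · rw [finrank_param l0 (LinearMap.inr ℝ _ _) LinearMap.inr_injective]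
    · simp [Module.finrank_matrix]
    · rintro ⟨M, N⟩
      rw [mem0]
      simp [eq_comm]
  · rw [finrank_param le_rfl LinearMap.id Function.injective_id]
    · simp [Module.finrank_matrix]
    · intro X
      simp [PQ_mem]
  · apply le_antisymm
    · exact sup_le (sup_le (sup_le l2 l1) l0) ln
    · intro B hB
      obtain ⟨⟨M, N⟩, rfl⟩ := PQ_surj hB
      rw [le_sup_aux]
      refine Submodule.add_mem_sup (Submodule.add_mem_sup (Submodule.add_mem_sup ?_ ?_) ?_) ?_
      · rw [mem2]; simp
      · rw [mem1]
        refine ⟨?_, rfl⟩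
        ext i j; simp; ring
      · rw [mem0]
      · rw [memn]
        refine ⟨?_, ?_, rfl⟩
        · simp [add_comm]
        · simp [Matrix.trace_sub, Matrix.trace_smul, Matrix.trace_add]
          ring
end

section
/- Fix ρ₀, μ₀ ∈ ℝ and define for smooth compactly supported fields h : ℝ⁴ → Sym₄(ℝ) (symmetric 4×4 matrices) and ξ : ℝ⁴ → ℝ³ the Lagrangian density L[h,ξ] := ρ₀ L_GR[h] + μ₀ L'[h,ξ], where L_GR[h] := (1/2)∑_{μ,ν,ρ}(∂_μ h_{νρ})² − (1/2)∑_μ(∂_μ tr h)² − (tr h)·∑_{μ,ν}∂_μ∂_ν h_{μν} − ∑_ν(∑_μ ∂_μ h_{μν})², and L'[h,ξ] := −(1/4)∑_μ(∂_μ tr h)² − (1/2)(tr h)∑_{μ,ν}∂_μ∂_ν h_{μν} − (1/4)∑_ν(∑_μ ∂_μ h_{μν})² − ∑_{μ,i}(∂_μ ξ^i)² + ∑_{i,μ,ν,α}(∂_μ h_{μν})(∂_α ξ^i) Sⁱ_{αν}. Then for every smooth compactly supported vector field X : ℝ⁴ → ℝ⁴, setting δh_{μν} := (1/2)(∂_μ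 X_ν + ∂_ν X_μ) and δξ^i := (1/4)∑_{μ,ν} Sⁱ_{μν} ∂_μ X_ν, the first variation vanishes: (d/dt)|_{t=0} ∫_{ℝ⁴} L[h + t·δh, ξ + t·δξ] dx = 0 for all smooth compactly supported h, ξ. -/
open Matrix BigOperators MeasureTheory

/-- Partial derivative `∂_μ f` of a scalar field on `ℝ⁴`. -/
noncomputable def pd (μ : Fin 4) (f : (Fin 4 → ℝ) → ℝ) (x : Fin 4 → ℝ) : ℝ :=
  fderiv ℝ f x (Pi.single μ 1)

/-- The linearised Einstein–Hilbert Lagrangian density `L_GR[h]`. -/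
noncomputable def LGR (h : (Fin 4 → ℝ) → Matrix (Fin 4) (Fin 4) ℝ)
    (x : Fin 4 → ℝ) : ℝ :=
  (1 / 2) * (∑ μ, ∑ ν, ∑ ρ, (pd μ (fun y => h y ν ρ) x) ^ 2)
    - (1 / 2) * (∑ μ, (pd μ (fun y => ∑ ν, h y ν ν) x) ^ 2)
    - (∑ ν, h x ν ν) * (∑ μ, ∑ ν, pd μ (fun z => pd ν (fun y => h y μ ν) z) x)
    - ∑ ν, (∑ μ, pd μ (fun y => h y μ ν) x) ^ 2

/-- The second diffeomorphism-invariant Lagrangian density `L'[h,ξ]`. -/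
noncomputable def Lpr (h : (Fin 4 → ℝ) → Matrix (Fin 4) (Fin 4) ℝ)
    (ξ : (Fin 4 → ℝ) → Fin 3 → ℝ) (x : Fin 4 → ℝ) : ℝ :=
  -(1 / 4) * (∑ μ, (pd μ (fun y => ∑ ν, h y ν ν) x) ^ 2)
    - (1 / 2) * (∑ ν, h x ν ν)
        * (∑ μ, ∑ ν, pd μ (fun z => pd ν (fun y => h y μ ν) z) x)
    - (1 / 4) * (∑ ν, (∑ μ, pd μ (fun y => h y μ ν) x) ^ 2)
    - (∑ μ, ∑ i, (pd μ (fun y => ξ y i) x) ^ 2)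
    + ∑ i, ∑ μ, ∑ ν, ∑ α,
        (pd μ (fun y => h y μ ν) x) * (pd α (fun y => ξ y i) x) * Scan i α ν

/-- Action of a linearised diffeomorphism with generator `X` on `h`:
`δh_{μν} = (1/2)(∂_μ X_ν + ∂_ν X_μ)`. -/
noncomputable def deltaH (X : (Fin 4 → ℝ) → Fin 4 → ℝ) (x : Fin 4 → ℝ) :
    Matrix (Fin 4) (Fin 4) ℝ :=
  Matrix.of fun μ ν => (1 / 2) * (pd μ (fun y => X y ν) x + pd ν (fun y => X y μ) x)

/-- Action of a linearised diffeomorphism with generator `X` on `ξ`: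
`δξ^i = (1/4) ∑ Sⁱ_{μν} ∂_μ X_ν`. -/
noncomputable def deltaXi (X : (Fin 4 → ℝ) → Fin 4 → ℝ) (x : Fin 4 → ℝ) :
    Fin 3 → ℝ :=
  fun i => (1 / 4) * ∑ μ, ∑ ν, Scan i μ ν * pd μ (fun y => X y ν) x

section Abstract
variable {A : Type*} [AddCommGroup A] [Module ℝ A] (D : Fin 4 → A →ₗ[ℝ] A) (B : A →ₗ[ℝ] A →ₗ[ℝ] ℝ)

/-- abstract action for `LGR` -/
noncomputable def QGR (h : Fin 4 → Fin 4 → A) : ℝ :=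
  (1 / 2) * (∑ μ, ∑ ν, ∑ ρ, B (D μ (h ν ρ)) (D μ (h ν ρ)))
    - (1 / 2) * (∑ μ, B (D μ (∑ ν, h ν ν)) (D μ (∑ ν, h ν ν)))
    - B (∑ ν, h ν ν) (∑ μ, ∑ ν, D μ (D ν (h μ ν)))
    - ∑ ν, B (∑ μ, D μ (h μ ν)) (∑ μ, D μ (h μ ν))

/-- abstract action for `Lpr` -/
noncomputable def QPR (h : Fin 4 → Fin 4 → A) (ξ : Fin 3 → A) : ℝ :=
  -(1 / 4) * (∑ μ, B (D μ (∑ ν, h ν ν)) (D μ (∑ ν, h ν ν)))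
    - (1 / 2) * B (∑ ν, h ν ν) (∑ μ, ∑ ν, D μ (D ν (h μ ν)))
    - (1 / 4) * (∑ ν, B (∑ μ, D μ (h μ ν)) (∑ μ, D μ (h μ ν)))
    - (∑ μ, ∑ i, B (D μ (ξ i)) (D μ (ξ i)))
    + ∑ i, ∑ μ, ∑ ν, ∑ α, B (D μ (h μ ν)) (D α (ξ i)) * Scan i α ν

theorem hasDerivAt_bil (u v w z : A) :
    HasDerivAt (fun t : ℝ => B (u + t • v) (w + t • z)) (B u z + B v w) 0 := by
  have e : (fun t : ℝ => B (u + t • v) (w + t • z)) =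
      fun t => B u w + t * (B u z + B v w) + t ^ 2 * B v z := by
    funext t
    simp only [map_add, map_smul, LinearMap.add_apply, LinearMap.smul_apply, smul_eq_mul]
    ring
  rw [e]
  have h1 := ((hasDerivAt_id (0:ℝ)).mul_const (B u z + B v w)).const_add (B u w)
  have h2 := ((hasDerivAt_id (0:ℝ)).pow 2).mul_const (B v z)
  exact (h1.add h2).congr_deriv (by simp)

theorem hasDerivAt_fsum {ι : Type*} [Fintype ι] {f : ι → ℝ → ℝ} {f' : ι → ℝ}
    (hf : ∀ i, HasDerivAt (f i) (f' i) 0) :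
    HasDerivAt (fun t => ∑ i, f i t) (∑ i, f' i) 0 :=
  HasDerivAt.fun_sum fun i _ => hf i

/-- abstract `deltaH` -/
noncomputable def dH (X : Fin 4 → A) (μ ν : Fin 4) : A := (1 / 2 : ℝ) • (D μ (X ν) + D ν (X μ))

/-- abstract `deltaXi` -/
noncomputable def dXi (X : Fin 4 → A) (i : Fin 3) : A :=
  (1 / 4 : ℝ) • ∑ μ, ∑ ν, Scan i μ ν • D μ (X ν)

/-- divergence -/
def dv (X : Fin 4 → A) : A := ∑ μ, D μ (X μ)
/-- Laplacian -/
def lap (f : A) : A := ∑ μ, D μ (D μ f)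

theorem tr_dH (X : Fin 4 → A) : ∑ ν, dH D X ν ν = dv D X := by
  unfold dH dv
  refine Finset.sum_congr rfl fun ν _ => ?_
  module

theorem div_dH (hc : ∀ μ ν f, D μ (D ν f) = D ν (D μ f))
    (X : Fin 4 → A) (ν : Fin 4) :
    ∑ μ, D μ (dH D X μ ν) = (1 / 2 : ℝ) • (lap D (X ν) + D ν (dv D X)) := by
  simp only [dH, dv, lap, map_smul, map_add, map_sum, ← Finset.smul_sum, Finset.sum_add_distrib]
  simp only [hc ν]

theorem divdiv_dH (hc : ∀ μ ν f, D μ (D ν f) = D ν (D μ f))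
    (X : Fin 4 → A) :
    ∑ μ, ∑ ν, D μ (D ν (dH D X μ ν)) = lap D (dv D X) := by
  have : ∀ μ, ∑ ν, D μ (D ν (dH D X μ ν)) =
      (1 / 2 : ℝ) • (D μ (lap D (X μ)) + D μ (D μ (dv D X))) := by
    intro μ
    rw [← map_sum, ← map_add, ← map_smul, ← div_dH D hc]
    simp only [dH, add_comm]
  simp only [this, ← Finset.smul_sum, Finset.sum_add_distrib]
  have h2 : ∑ μ, D μ (lap D (X μ)) = lap D (dv D X) := by
    simp only [lap, dv, map_sum]
    rw [Finset.sum_comm]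
    refine Finset.sum_congr rfl fun i _ => Finset.sum_congr rfl fun j _ => ?_
    rw [hc j i, hc j i]
  rw [h2]
  change (1/2:ℝ) • (_ + lap D (dv D X)) = _
  module

theorem B_lap (hD : ∀ μ f g, B (D μ f) g = - B f (D μ g))
    (f g : A) : ∑ μ, B (D μ f) (D μ g) = - B f (lap D g) := by
  simp only [hD, lap, map_sum, Finset.sum_neg_distrib]

theorem B_dd (hB : ∀ f g, B f g = B g f) (hD : ∀ μ f g, B (D μ f) g = - B f (D μ g))
    (d : A) (h : Fin 4 → Fin 4 → A) :
    B d (∑ μ, ∑ ν, D μ (D ν (h μ ν))) = - ∑ ν, B (∑ μ, D μ (h ν μ)) (D ν d) := by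
  simp only [map_sum, LinearMap.sum_apply, ← Finset.sum_neg_distrib]
  refine Finset.sum_congr rfl fun i _ => Finset.sum_congr rfl fun j _ => ?_
  rw [hB, hD]


theorem QGR_hasDeriv (h k : Fin 4 → Fin 4 → A) :
    HasDerivAt (fun t : ℝ => QGR D B (fun μ ν => h μ ν + t • k μ ν))
      ((1 / 2) * (∑ μ, ∑ ν, ∑ ρ, (B (D μ (h ν ρ)) (D μ (k ν ρ)) + B (D μ (k ν ρ)) (D μ (h ν ρ))))
    - (1 / 2) * (∑ μ, (B (D μ (∑ ν, h ν ν)) (D μ (∑ ν, k ν ν))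
        + B (D μ (∑ ν, k ν ν)) (D μ (∑ ν, h ν ν))))
    - (B (∑ ν, h ν ν) (∑ μ, ∑ ν, D μ (D ν (k μ ν)))
        + B (∑ ν, k ν ν) (∑ μ, ∑ ν, D μ (D ν (h μ ν))))
    - ∑ ν, (B (∑ μ, D μ (h μ ν)) (∑ μ, D μ (k μ ν))
        + B (∑ μ, D μ (k μ ν)) (∑ μ, D μ (h μ ν)))) 0 := by
  unfold QGR
  have e1 : ∀ (t : ℝ) μ ν ρ, D μ (h ν ρ + t • k ν ρ) = D μ (h ν ρ) + t • D μ (k ν ρ) := by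
    intros; simp
  have e2 : ∀ t : ℝ, ∑ ν, (h ν ν + t • k ν ν) = ∑ ν, h ν ν + t • ∑ ν, k ν ν := by
    intros; simp [Finset.sum_add_distrib, Finset.smul_sum]
  have e3 : ∀ (t : ℝ) (u v : A) μ, D μ (u + t • v) = D μ u + t • D μ v := by
    intros; simp
  have e4 : ∀ (t : ℝ) (u v : Fin 4 → A), ∑ μ, (u μ + t • v μ) = ∑ μ, u μ + t • ∑ μ, v μ := by
    intros; simp [Finset.sum_add_distrib, Finset.smul_sum]
  simp only [e3, e4]
  refine HasDerivAt.sub (HasDerivAt.sub (HasDerivAt.sub (HasDerivAt.const_mul _ ?_)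
    (HasDerivAt.const_mul _ ?_)) ?_) ?_
  · exact hasDerivAt_fsum fun _ => hasDerivAt_fsum fun _ => hasDerivAt_fsum fun _ =>
      hasDerivAt_bil B _ _ _ _
  · exact hasDerivAt_fsum fun _ => hasDerivAt_bil B _ _ _ _
  · exact hasDerivAt_bil B _ _ _ _
  · exact hasDerivAt_fsum fun _ => hasDerivAt_bil B _ _ _ _

theorem QPR_hasDeriv (h k : Fin 4 → Fin 4 → A) (ξ η : Fin 3 → A) :
    HasDerivAt (fun t : ℝ => QPR D B (fun μ ν => h μ ν + t • k μ ν) (fun i => ξ i + t • η i))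
      (-(1 / 4) * (∑ μ, (B (D μ (∑ ν, h ν ν)) (D μ (∑ ν, k ν ν))
        + B (D μ (∑ ν, k ν ν)) (D μ (∑ ν, h ν ν))))
    - (1 / 2) * (B (∑ ν, h ν ν) (∑ μ, ∑ ν, D μ (D ν (k μ ν)))
        + B (∑ ν, k ν ν) (∑ μ, ∑ ν, D μ (D ν (h μ ν))))
    - (1 / 4) * (∑ ν, (B (∑ μ, D μ (h μ ν)) (∑ μ, D μ (k μ ν))
        + B (∑ μ, D μ (k μ ν)) (∑ μ, D μ (h μ ν))))
    - (∑ μ, ∑ i, (B (D μ (ξ i)) (D μ (η i)) + B (D μ (η i)) (D μ (ξ i))))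
    + ∑ i, ∑ μ, ∑ ν, ∑ α, (B (D μ (h μ ν)) (D α (η i)) + B (D μ (k μ ν)) (D α (ξ i)))
        * Scan i α ν) 0 := by
  unfold QPR
  have e3 : ∀ (t : ℝ) (u v : A) μ, D μ (u + t • v) = D μ u + t • D μ v := by
    intros; simp
  have e4 : ∀ (t : ℝ) (u v : Fin 4 → A), ∑ μ, (u μ + t • v μ) = ∑ μ, u μ + t • ∑ μ, v μ := by
    intros; simp [Finset.sum_add_distrib, Finset.smul_sum]
  simp only [e3, e4]
  refine HasDerivAt.add (HasDerivAt.sub (HasDerivAt.sub (HasDerivAt.sub (HasDerivAt.const_mul _ ?_)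
    (HasDerivAt.const_mul _ ?_)) (HasDerivAt.const_mul _ ?_)) ?_) ?_
  · exact hasDerivAt_fsum fun _ => hasDerivAt_bil B _ _ _ _
  · exact hasDerivAt_bil B _ _ _ _
  · exact hasDerivAt_fsum fun _ => hasDerivAt_bil B _ _ _ _
  · exact hasDerivAt_fsum fun _ => hasDerivAt_fsum fun _ => hasDerivAt_bil B _ _ _ _
  · exact hasDerivAt_fsum fun _ => hasDerivAt_fsum fun _ => hasDerivAt_fsum fun _ =>
      hasDerivAt_fsum fun _ => (hasDerivAt_bil B _ _ _ _).mul_const _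

theorem B_term1 (hD : ∀ μ f g, B (D μ f) g = - B f (D μ g)) (hc : ∀ μ ν f, D μ (D ν f) = D ν (D μ f))
    (h : Fin 4 → Fin 4 → A) (hs : ∀ μ ν, h μ ν = h ν μ) (X : Fin 4 → A) :
    ∑ μ, ∑ ν, ∑ ρ, B (D μ (h ν ρ)) (D μ (dH D X ν ρ))
      = ∑ ν, B (∑ μ, D μ (h μ ν)) (lap D (X ν)) := by
  have h0 : ∀ μ, ∑ ν, ∑ ρ, B (D μ (h ν ρ)) (D μ (dH D X ν ρ))
      = ∑ ν, ∑ ρ, B (D μ (h ν ρ)) (D μ (D ν (X ρ))) := by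
    intro μ
    simp only [dH, map_smul, map_add, smul_eq_mul, mul_add, Finset.sum_add_distrib]
    have : ∑ ν, ∑ ρ, (1 / 2 : ℝ) * B (D μ (h ν ρ)) (D μ (D ρ (X ν))) =
        ∑ ν, ∑ ρ, (1 / 2 : ℝ) * B (D μ (h ν ρ)) (D μ (D ν (X ρ))) := by
      rw [Finset.sum_comm]
      refine Finset.sum_congr rfl fun i _ => Finset.sum_congr rfl fun j _ => ?_
      rw [hs]
    rw [this]
    simp only [← Finset.mul_sum]
    ring
  simp only [h0]
  have h1 : ∀ μ ν ρ, B (D μ (h ν ρ)) (D μ (D ν (X ρ))) = B (D ν (h ν ρ)) (D μ (D μ (X ρ))) := by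
    intro μ ν ρ
    rw [hD, hD, hc μ ν, hc μ ν]
  rw [Finset.sum_congr rfl fun μ _ => Finset.sum_congr rfl fun ν _ =>
    Finset.sum_congr rfl fun ρ _ => h1 μ ν ρ, Finset.sum_comm_cycle]
  simp only [lap, map_sum, LinearMap.sum_apply]

theorem QGR_deriv (hB : ∀ f g, B f g = B g f) (hD : ∀ μ f g, B (D μ f) g = - B f (D μ g)) (hc : ∀ μ ν f, D μ (D ν f) = D ν (D μ f))
    (h : Fin 4 → Fin 4 → A) (hs : ∀ μ ν, h μ ν = h ν μ) (X : Fin 4 → A) :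
    HasDerivAt (fun t : ℝ => QGR D B (fun μ ν => h μ ν + t • dH D X μ ν)) 0 0 := by
  refine (QGR_hasDeriv D B h (dH D X)).congr_deriv ?_
  simp only [tr_dH, div_dH D hc, divdiv_dH D hc]
  have s1 : ∀ μ ν ρ, B (D μ (dH D X ν ρ)) (D μ (h ν ρ)) = B (D μ (h ν ρ)) (D μ (dH D X ν ρ)) :=
    fun _ _ _ => hB _ _
  rw [B_dd D B hB hD]
  simp only [hB (D _ (dv D X)) (D _ (∑ ν, h ν ν)), s1, ← two_mul, ← Finset.mul_sum, 
    B_term1 D B hD hc h hs, B_lap D B hD, hB ((1 / 2 : ℝ) • _)]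
  simp only [map_smul, map_add, smul_eq_mul, Finset.sum_add_distrib, ← Finset.mul_sum]
  have : ∀ ν, ∑ μ, D μ (h ν μ) = ∑ μ, D μ (h μ ν) := fun ν => by simp only [hs ν]
  simp only [this]
  ring

theorem Scan_rel (ν : Fin 4) (Y : Fin 4 → Fin 4 → Fin 4 → A) (hY : ∀ α ρ σ, Y α ρ σ = Y ρ α σ) :
    ∑ α, ∑ i, Scan i α ν • ∑ ρ, ∑ σ, Scan i ρ σ • Y α ρ σ = ∑ μ, Y μ μ ν - ∑ μ, Y ν μ μ := by
  fin_cases ν <;> simp [Scan, Fin.sum_univ_succ] <;>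
  simp only [hY 1 0, hY 2 0, hY 3 0, hY 2 1, hY 3 1, hY 3 2] <;> abel

theorem Scan_antisymm (i : Fin 3) (α ν : Fin 4) : Scan i α ν = - Scan i ν α := by
  fin_cases i <;> fin_cases α <;> fin_cases ν <;> simp [Scan]

theorem Scan_symm_zero (i : Fin 3) (Y : Fin 4 → Fin 4 → A) (hY : ∀ α ρ, Y α ρ = Y ρ α) :
    ∑ α, ∑ ν, Scan i α ν • Y α ν = 0 := by
  fin_cases i <;> simp [Scan, Fin.sum_univ_succ] <;>
  simp only [hY 1 0, hY 2 0, hY 3 0, hY 2 1, hY 3 1, hY 3 2] <;> abel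

theorem QPR_T1 (hc : ∀ μ ν f, D μ (D ν f) = D ν (D μ f))
    (h : Fin 4 → Fin 4 → A) (X : Fin 4 → A) :
    ∑ i, ∑ μ, ∑ ν, ∑ α, B (D μ (h μ ν)) (D α (dXi D X i)) * Scan i α ν
      = (1 / 4) * ∑ ν, B (∑ μ, D μ (h μ ν)) (lap D (X ν) - D ν (dv D X)) := by
  have key : ∀ ν, ∑ α, ∑ i, Scan i α ν • D α (dXi D X i)
      = (1 / 4 : ℝ) • (lap D (X ν) - D ν (dv D X)) := by
    intro ν
    have := Scan_rel ν (fun α ρ σ => D α (D ρ (X σ))) (fun α ρ σ => hc _ _ _)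
    simp only [lap, dv, map_sum]
    rw [← this, Finset.smul_sum]
    refine Finset.sum_congr rfl fun α _ => ?_
    rw [Finset.smul_sum]
    refine Finset.sum_congr rfl fun i _ => ?_
    simp only [dXi, map_smul, map_sum]
    rw [smul_comm]
  have k2 : ∀ ν, (1 / 4) * B (∑ μ, D μ (h μ ν)) (lap D (X ν) - D ν (dv D X))
      = ∑ i, ∑ μ, ∑ α, B (D μ (h μ ν)) (D α (dXi D X i)) * Scan i α ν := by
    intro ν
    rw [← smul_eq_mul, ← map_smul, ← key, Finset.sum_comm]
    simp only [map_sum, LinearMap.sum_apply, map_smul, smul_eq_mul, Finset.mul_sum]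
    refine Finset.sum_congr rfl fun i _ => ?_
    rw [Finset.sum_comm]
    refine Finset.sum_congr rfl fun μ _ => Finset.sum_congr rfl fun α _ => ?_
    ring
  rw [Finset.mul_sum]
  simp only [k2]
  symm
  rw [Finset.sum_comm]
  refine Finset.sum_congr rfl fun i _ => ?_
  rw [Finset.sum_comm]

theorem QPR_T2 (hB : ∀ f g, B f g = B g f) (hD : ∀ μ f g, B (D μ f) g = - B f (D μ g)) (hc : ∀ μ ν f, D μ (D ν f) = D ν (D μ f))
    (ξ : Fin 3 → A) (X : Fin 4 → A) :
    ∑ i, ∑ μ, ∑ ν, ∑ α, B (D μ (dH D X μ ν)) (D α (ξ i)) * Scan i α ν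
      = -2 * ∑ i, B (ξ i) (lap D (dXi D X i)) := by
  rw [Finset.mul_sum]
  refine Finset.sum_congr rfl fun i _ => ?_
  have key : ∑ α, ∑ ν, Scan i α ν • D α (∑ μ, D μ (dH D X μ ν)) = (2 : ℝ) • lap D (dXi D X i) := by
    simp only [div_dH D hc, map_smul, map_add, smul_add, Finset.sum_add_distrib]
    have z : ∑ α, ∑ ν, Scan i α ν • (1 / 2 : ℝ) • D α (D ν (dv D X)) = 0 :=
      Scan_symm_zero i (fun α ν => (1 / 2 : ℝ) • D α (D ν (dv D X))) fun α ρ => by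
        simp only [hc α ρ]
    rw [z, add_zero]
    simp only [lap, dXi, map_sum, map_smul, Finset.smul_sum, smul_smul]
    rw [Finset.sum_comm_cycle]
    refine Finset.sum_congr rfl fun μ _ => Finset.sum_congr rfl fun α _ =>
      Finset.sum_congr rfl fun ν _ => ?_
    rw [hc μ α, hc μ α]
    congr 1
    ring
  have : -2 * B (ξ i) (lap D (dXi D X i)) = - B (ξ i) ((2 : ℝ) • lap D (dXi D X i)) := by
    rw [map_smul, smul_eq_mul]; ring
  rw [this, ← key]
  simp only [map_sum, map_smul, smul_eq_mul, Finset.mul_sum]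
  rw [Finset.sum_comm_cycle, ← Finset.sum_neg_distrib]
  refine Finset.sum_congr rfl fun α _ => ?_
  rw [Finset.sum_comm, ← Finset.sum_neg_distrib]
  refine Finset.sum_congr rfl fun ν _ => ?_
  rw [← Finset.sum_neg_distrib]
  refine Finset.sum_congr rfl fun μ _ => ?_
  rw [hB, hD]
  ring

theorem QPR_deriv (hB : ∀ f g, B f g = B g f) (hD : ∀ μ f g, B (D μ f) g = - B f (D μ g)) (hc : ∀ μ ν f, D μ (D ν f) = D ν (D μ f))
    (h : Fin 4 → Fin 4 → A) (hs : ∀ μ ν, h μ ν = h ν μ) (ξ : Fin 3 → A)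
    (X : Fin 4 → A) :
    HasDerivAt (fun t : ℝ => QPR D B (fun μ ν => h μ ν + t • dH D X μ ν)
      (fun i => ξ i + t • dXi D X i)) 0 0 := by
  refine (QPR_hasDeriv D B h (dH D X) ξ (dXi D X)).congr_deriv ?_
  simp only [add_mul, Finset.sum_add_distrib]
  rw [QPR_T1 D B hc, QPR_T2 D B hB hD hc]
  simp only [tr_dH, div_dH D hc, divdiv_dH D hc]
  have s1 : ∀ μ i, B (D μ (dXi D X i)) (D μ (ξ i)) = B (D μ (ξ i)) (D μ (dXi D X i)) :=
    fun _ _ => hB _ _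
  rw [B_dd D B hB hD]
  simp only [s1]
  rw [Finset.sum_comm (f := fun μ i => B (D μ (ξ i)) (D μ (dXi D X i)))]
  simp only [hB (D _ (dv D X)) (D _ (∑ ν, h ν ν)), B_lap D B hD, hB ((1 / 2 : ℝ) • _)]
  simp only [map_smul, map_add, map_sub, smul_eq_mul, Finset.sum_add_distrib, ← Finset.mul_sum,
    Finset.sum_sub_distrib, Finset.sum_neg_distrib]
  have : ∀ ν, ∑ μ, D μ (h ν μ) = ∑ μ, D μ (h μ ν) := fun ν => by simp only [hs ν]
  simp only [this]
  ring

end Abstract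

/-- smooth compactly supported functions -/
def TA : Submodule ℝ ((Fin 4 → ℝ) → ℝ) where
  carrier := {f | ContDiff ℝ (⊤ : ℕ∞) f ∧ HasCompactSupport f}
  add_mem' := fun ha hb => ⟨ha.1.add hb.1, ha.2.add hb.2⟩
  zero_mem' := ⟨contDiff_const, HasCompactSupport.zero⟩
  smul_mem' := fun c _ hf => ⟨contDiff_const.smul hf.1, hf.2.smul_left (f := fun _ => c)⟩

theorem pd_mem (μ : Fin 4) {f : (Fin 4 → ℝ) → ℝ} (hf : f ∈ TA) : pd μ f ∈ TA :=
  ⟨(hf.1.fderiv_right (m := (⊤ : ℕ∞)) (by exact_mod_cast le_rfl)).clm_apply contDiff_const,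
    hf.2.fderiv_apply (𝕜 := ℝ) _⟩

theorem TA_diff (f : TA) : Differentiable ℝ (f : (Fin 4 → ℝ) → ℝ) :=
  f.2.1.differentiable (by simp)

theorem TA_int (f g : TA) : Integrable (fun x => f.1 x * g.1 x) :=
  (f.2.1.continuous.mul g.2.1.continuous).integrable_of_hasCompactSupport (f.2.2.mul_right)

/-- partial derivative as a linear map -/
noncomputable def DA (μ : Fin 4) : TA →ₗ[ℝ] TA where
  toFun f := ⟨pd μ f.1, pd_mem μ f.2⟩
  map_add' f g := by
    ext x
    simp only [pd, Submodule.coe_add, Pi.add_apply]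
    rw [fderiv_add (TA_diff f x) (TA_diff g x)]; rfl
  map_smul' c f := by
    ext x
    simp only [pd, Submodule.coe_smul, Pi.smul_apply, RingHom.id_apply]
    rw [fderiv_const_smul (TA_diff f x)]; rfl

/-- the `L²` pairing -/
noncomputable def BA : TA →ₗ[ℝ] TA →ₗ[ℝ] ℝ :=
  LinearMap.mk₂ ℝ (fun f g => ∫ x, f.1 x * g.1 x)
    (fun f f' g => by
      rw [← integral_add (TA_int f g) (TA_int f' g)]
      congr 1; funext x; simp [add_mul])
    (fun c f g => by
      rw [smul_eq_mul, ← integral_const_mul]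
      congr 1; funext x; simp [mul_assoc])
    (fun f g g' => by
      rw [← integral_add (TA_int f g) (TA_int f g')]
      congr 1; funext x; simp [mul_add])
    (fun c f g => by
      rw [smul_eq_mul, ← integral_const_mul]
      congr 1; funext x; simp [mul_left_comm])

theorem BA_symm (f g : TA) : BA f g = BA g f := by
  simp only [BA, LinearMap.mk₂_apply, mul_comm]

theorem BA_parts (μ : Fin 4) (f g : TA) : BA (DA μ f) g = - BA f (DA μ g) := by
  simp only [BA, LinearMap.mk₂_apply]
  have := integral_mul_fderiv_eq_neg_fderiv_mul_of_integrable (μ := volume) (f := f.1) (g := g.1)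
    (v := Pi.single μ 1) (TA_int (DA μ f) g) (TA_int f (DA μ g)) (TA_int f g)
    (fun x _ => TA_diff f x) (fun x _ => TA_diff g x)
  rw [eq_neg_iff_add_eq_zero, add_comm, ← eq_neg_iff_add_eq_zero]
  exact this

theorem DA_comm (μ ν : Fin 4) (f : TA) : DA μ (DA ν f) = DA ν (DA μ f) := by
  ext x
  have hd : DifferentiableAt ℝ (fderiv ℝ f.1) x :=
    ((f.2.1.fderiv_right (m := (⊤ : ℕ∞)) (by exact_mod_cast le_rfl)).differentiable (by simp)) x
  have e : ∀ a b : Fin 4, (DA a (DA b f)).1 x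
      = fderiv ℝ (fderiv ℝ f.1) x (Pi.single a 1) (Pi.single b 1) := by
    intro a b
    change fderiv ℝ (fun y => fderiv ℝ f.1 y (Pi.single b 1)) x (Pi.single a 1) = _
    rw [fderiv_clm_apply hd (differentiableAt_const _)]
    simp
  change (DA μ (DA ν f)).1 x = (DA ν (DA μ f)).1 x
  rw [e, e]
  exact (f.2.1.contDiffAt.isSymmSndFDerivAt
    (by rw [minSmoothness_of_isRCLikeNormedField]; exact WithTop.coe_le_coe.2 (le_top : (2 : ℕ∞) ≤ ⊤))) _ _

/-- integrable with given integral -/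
def HasInt (f : (Fin 4 → ℝ) → ℝ) (c : ℝ) : Prop := Integrable f ∧ ∫ x, f x = c

theorem HasInt.add {f g : (Fin 4 → ℝ) → ℝ} {a b : ℝ} (hf : HasInt f a) (hg : HasInt g b) :
    HasInt (fun x => f x + g x) (a + b) :=
  ⟨hf.1.add hg.1, by rw [integral_add hf.1 hg.1, hf.2, hg.2]⟩

theorem HasInt.sub {f g : (Fin 4 → ℝ) → ℝ} {a b : ℝ} (hf : HasInt f a) (hg : HasInt g b) :
    HasInt (fun x => f x - g x) (a - b) :=
  ⟨hf.1.sub hg.1, by rw [integral_sub hf.1 hg.1, hf.2, hg.2]⟩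

theorem HasInt.cmul {f : (Fin 4 → ℝ) → ℝ} {a : ℝ} (c : ℝ) (hf : HasInt f a) :
    HasInt (fun x => c * f x) (c * a) :=
  ⟨hf.1.const_mul c, by rw [integral_const_mul, hf.2]⟩

theorem HasInt.mulc {f : (Fin 4 → ℝ) → ℝ} {a : ℝ} (c : ℝ) (hf : HasInt f a) :
    HasInt (fun x => f x * c) (a * c) :=
  ⟨hf.1.mul_const c, by rw [integral_mul_const, hf.2]⟩

theorem HasInt.fsum {ι : Type*} [Fintype ι] {f : ι → (Fin 4 → ℝ) → ℝ} {a : ι → ℝ}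
    (hf : ∀ i, HasInt (f i) (a i)) : HasInt (fun x => ∑ i, f i x) (∑ i, a i) :=
  ⟨integrable_finsetSum _ fun i _ => (hf i).1, by
    rw [integral_finsetSum _ fun i _ => (hf i).1]
    exact Finset.sum_congr rfl fun i _ => (hf i).2⟩

theorem HasInt.bil (f g : TA) : HasInt (fun x => f.1 x * g.1 x) (BA f g) :=
  ⟨TA_int f g, rfl⟩

theorem HasInt.sq (f : TA) : HasInt (fun x => f.1 x ^ 2) (BA f f) := by
  simp only [pow_two]; exact HasInt.bil f f

theorem TA_sum_apply {ι : Type*} [Fintype ι] (f : ι → TA) (x : Fin 4 → ℝ) :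
    (∑ i, f i).1 x = ∑ i, (f i).1 x := by
  rw [Submodule.coe_sum, Finset.sum_apply]

theorem DA_apply (μ : Fin 4) (f : TA) (x : Fin 4 → ℝ) : (DA μ f).1 x = pd μ (fun y => f.1 y) x := rfl

theorem LGR_hasInt (g : Fin 4 → Fin 4 → TA) :
    HasInt (LGR (fun y => Matrix.of fun μ ν => (g μ ν).1 y)) (QGR DA BA g) := by
  have e : LGR (fun y => Matrix.of fun μ ν => (g μ ν).1 y) = fun x =>
      (1 / 2) * (∑ μ, ∑ ν, ∑ ρ, ((DA μ (g ν ρ)).1 x) ^ 2)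
    - (1 / 2) * (∑ μ, ((DA μ (∑ ν, g ν ν)).1 x) ^ 2)
    - (∑ ν, g ν ν).1 x * (∑ μ, ∑ ν, DA μ (DA ν (g μ ν))).1 x
    - ∑ ν, ((∑ μ, DA μ (g μ ν)).1 x) ^ 2 := by
    funext x
    simp only [LGR, TA_sum_apply, DA_apply, Matrix.of_apply]
  rw [e]
  exact (((HasInt.cmul _ (.fsum fun _ => .fsum fun _ => .fsum fun _ => .sq _)).sub
    (.cmul _ (.fsum fun _ => .sq _))).sub (.bil _ _)).sub (.fsum fun _ => .sq _)

theorem Lpr_hasInt (g : Fin 4 → Fin 4 → TA) (ξ : Fin 3 → TA) :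
    HasInt (Lpr (fun y => Matrix.of fun μ ν => (g μ ν).1 y) (fun y i => (ξ i).1 y))
      (QPR DA BA g ξ) := by
  have e : Lpr (fun y => Matrix.of fun μ ν => (g μ ν).1 y) (fun y i => (ξ i).1 y) = fun x =>
      -(1 / 4) * (∑ μ, ((DA μ (∑ ν, g ν ν)).1 x) ^ 2)
    - (1 / 2) * ((∑ ν, g ν ν).1 x * (∑ μ, ∑ ν, DA μ (DA ν (g μ ν))).1 x)
    - (1 / 4) * (∑ ν, ((∑ μ, DA μ (g μ ν)).1 x) ^ 2)
    - (∑ μ, ∑ i, ((DA μ (ξ i)).1 x) ^ 2)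
    + ∑ i, ∑ μ, ∑ ν, ∑ α, (DA μ (g μ ν)).1 x * (DA α (ξ i)).1 x * Scan i α ν := by
    funext x
    simp only [Lpr, TA_sum_apply, DA_apply, Matrix.of_apply, mul_assoc]
  rw [e]
  exact ((((HasInt.cmul _ (.fsum fun _ => .sq _)).sub (.cmul _ (.bil _ _))).sub
    (.cmul _ (.fsum fun _ => .sq _))).sub (.fsum fun _ => .fsum fun _ => .sq _)).add
    (.fsum fun _ => .fsum fun _ => .fsum fun _ => .fsum fun _ => .mulc _ (.bil _ _))

/-- for any coefficients `ρ₀, μ₀`, the Lagrangian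
`ρ₀ L_GR + μ₀ L'` is invariant under linearised diffeomorphisms: the first
variation of its integral along `(δh, δξ)` vanishes for all smooth compactly
supported `h`, `ξ`, `X`. -/
theorem diffeo_invariance_of_LGR_Lpr (ρ₀ μ₀ : ℝ)
    (h : (Fin 4 → ℝ) → Matrix (Fin 4) (Fin 4) ℝ)
    (hsymm : ∀ x, (h x)ᵀ = h x)
    (hsm : ∀ μ ν, ContDiff ℝ (⊤ : ℕ∞) (fun x => h x μ ν))
    (hcs : ∀ μ ν, HasCompactSupport (fun x => h x μ ν))
    (ξ : (Fin 4 → ℝ) → Fin 3 → ℝ)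
    (ξsm : ∀ i, ContDiff ℝ (⊤ : ℕ∞) (fun x => ξ x i))
    (ξcs : ∀ i, HasCompactSupport (fun x => ξ x i))
    (X : (Fin 4 → ℝ) → Fin 4 → ℝ)
    (Xsm : ∀ μ, ContDiff ℝ (⊤ : ℕ∞) (fun x => X x μ))
    (Xcs : ∀ μ, HasCompactSupport (fun x => X x μ)) :
    deriv (fun t : ℝ =>
      ∫ x : Fin 4 → ℝ,
        (ρ₀ * LGR (fun y => h y + t • deltaH X y) x
          + μ₀ * Lpr (fun y => h y + t • deltaH X y)
              (fun y => ξ y + t • deltaXi X y) x)) 0 = 0 := by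
  let hA : Fin 4 → Fin 4 → TA := fun μ ν => ⟨fun x => h x μ ν, hsm μ ν, hcs μ ν⟩
  let ξA : Fin 3 → TA := fun i => ⟨fun x => ξ x i, ξsm i, ξcs i⟩
  let XA : Fin 4 → TA := fun μ => ⟨fun x => X x μ, Xsm μ, Xcs μ⟩
  have hs : ∀ μ ν, hA μ ν = hA ν μ := by
    intro μ ν
    apply Subtype.ext
    funext x
    exact congrFun (congrFun (hsymm x) ν) μ
  have eh : ∀ t : ℝ, (fun y => h y + t • deltaH X y) =
      fun y => Matrix.of fun μ ν => (hA μ ν + t • dH DA XA μ ν).1 y := by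
    intro t
    rfl
  have eξ : ∀ t : ℝ, (fun y => ξ y + t • deltaXi X y) =
      fun y i => (ξA i + t • dXi DA XA i).1 y := by
    intro t
    funext y i
    simp only [dXi, Submodule.coe_add, Submodule.coe_smul, Pi.add_apply, Pi.smul_apply,
      TA_sum_apply, deltaXi, smul_eq_mul, DA_apply]
    rfl
  have key : (fun t : ℝ => ∫ x : Fin 4 → ℝ,
        (ρ₀ * LGR (fun y => h y + t • deltaH X y) x
          + μ₀ * Lpr (fun y => h y + t • deltaH X y)
              (fun y => ξ y + t • deltaXi X y) x)) = fun t =>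
      ρ₀ * QGR DA BA (fun μ ν => hA μ ν + t • dH DA XA μ ν)
        + μ₀ * QPR DA BA (fun μ ν => hA μ ν + t • dH DA XA μ ν)
          (fun i => ξA i + t • dXi DA XA i) := by
    funext t
    rw [eh, eξ]
    exact (((LGR_hasInt _).cmul ρ₀).add ((Lpr_hasInt _ _).cmul μ₀)).2
  rw [key]
  have d := ((QGR_deriv DA BA BA_symm BA_parts DA_comm hA hs XA).const_mul ρ₀).add
    ((QPR_deriv DA BA BA_symm BA_parts DA_comm hA hs ξA XA).const_mul μ₀)
  rw [mul_zero, mul_zero, add_zero] at d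
  exact d.deriv
end

section
/- Let α, β, γ, ρ₀, λ, μ₀ ∈ ℝ and define for smooth compactly supported h : ℝ⁴ → Sym₄(ℝ) and ξ : ℝ⁴ → ℝ³ the Lagrangian density L[h,ξ] := (ρ₀/2)∑(∂_μ h_{νρ})² + (α/2)∑(∂_μ tr h)² − β (tr h)∑∂_μ∂_ν h_{μν} − γ ∑_ν(∑_μ ∂_μ h_{μν})² + (λ/2)∑(∂_μ ξ^i)² + μ₀ ∑_{i,μ,ν,α}(∂_μ h_{μν})(∂_α ξ^i) Sⁱ_{αν}. Suppose that for all smooth compactly supported h, ξ and every smooth compactly supported X : ℝ⁴ → ℝ⁴, with δh_{μν} := (1/2)(∂_μ X_ν + ∂_ν X_μ) and δξ^i := (1/4)∑_{μ,ν} Sⁱ_{μν} ∂_μ X_ν, one has (d/dt)|_{t=0} ∫_{ℝ⁴} L[h + t·δh, ξ + t·δξ] dx = 0. Then the coefficients satisfy β = −α = ρ₀ + μ₀/2, γ = ρ₀ + μ₀/4, and λ = −2μ₀. In other words, up to overall scale the two-parameter family ρ₀·L_GR + μ₀·L' exhausts all diffeomorphism-invariant second-order Lagrangians of this form. -/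
open Matrix BigOperators MeasureTheory

/-- The general second-order Lagrangian density with coefficients
`α, β, γ, ρ₀, λ, μ₀`. -/
noncomputable def Lgen (α β γ ρ₀ lam μ₀ : ℝ)
    (h : (Fin 4 → ℝ) → Matrix (Fin 4) (Fin 4) ℝ)
    (ξ : (Fin 4 → ℝ) → Fin 3 → ℝ) (x : Fin 4 → ℝ) : ℝ :=
  (ρ₀ / 2) * (∑ μ, ∑ ν, ∑ ρ, (pd μ (fun y => h y ν ρ) x) ^ 2)
    + (α / 2) * (∑ μ, (pd μ (fun y => ∑ ν, h y ν ν) x) ^ 2)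
    - β * (∑ ν, h x ν ν) * (∑ μ, ∑ ν, pd μ (fun z => pd ν (fun y => h y μ ν) z) x)
    - γ * (∑ ν, (∑ μ, pd μ (fun y => h y μ ν) x) ^ 2)
    + (lam / 2) * (∑ μ, ∑ i, (pd μ (fun y => ξ y i) x) ^ 2)
    + μ₀ * ∑ i, ∑ μ, ∑ ν, ∑ α',
        (pd μ (fun y => h y μ ν) x) * (pd α' (fun y => ξ y i) x) * Scan i α' ν

/-- smooth compactly supported -/
def Nice (f : (Fin 4 → ℝ) → ℝ) : Prop := ContDiff ℝ (⊤ : ℕ∞) f ∧ HasCompactSupport f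

namespace Nice
variable {f g : (Fin 4 → ℝ) → ℝ}

lemma zero : Nice (fun _ => 0) := ⟨contDiff_const, HasCompactSupport.zero⟩
lemma add (hf : Nice f) (hg : Nice g) : Nice (fun x => f x + g x) :=
  ⟨hf.1.add hg.1, hf.2.add hg.2⟩
lemma mul (hf : Nice f) (hg : Nice g) : Nice (fun x => f x * g x) :=
  ⟨hf.1.mul hg.1, hf.2.mul_right⟩
lemma smooth_mul (hf : ContDiff ℝ (⊤ : ℕ∞) f) (hg : Nice g) : Nice (fun x => f x * g x) :=
  ⟨hf.mul hg.1, hg.2.mul_left⟩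
lemma const_mul (c : ℝ) (hf : Nice f) : Nice (fun x => c * f x) :=
  smooth_mul contDiff_const hf
lemma mul_const (c : ℝ) (hf : Nice f) : Nice (fun x => f x * c) := by
  simpa [mul_comm] using const_mul c hf
lemma sub (hf : Nice f) (hg : Nice g) : Nice (fun x => f x - g x) := by
  simpa [sub_eq_add_neg] using hf.add (const_mul (-1) hg)
lemma sq (hf : Nice f) : Nice (fun x => f x ^ 2) := by
  simpa [pow_two] using hf.mul hf
lemma sum {ι : Type} [Fintype ι] {F : ι → (Fin 4 → ℝ) → ℝ} (hF : ∀ i, Nice (F i)) :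
    Nice (fun x => ∑ i, F i x) := by
  classical
  have : ∀ s : Finset ι, Nice (fun x => ∑ i ∈ s, F i x) := by
    intro s
    induction s using Finset.induction_on with
    | empty => simpa using zero
    | insert a s ha ih => simpa [Finset.sum_insert ha] using (hF a).add ih
  exact this _
lemma pd (μ : Fin 4) (hf : Nice f) : Nice (fun x => pd μ f x) := by
  refine ⟨?_, ?_⟩
  · unfold _root_.pd
    exact (hf.1.fderiv_right (m := (⊤ : ℕ∞)) le_rfl).clm_apply contDiff_const
  · unfold _root_.pd
    exact hf.2.fderiv_apply (𝕜 := ℝ) _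
lemma integrable (hf : Nice f) : Integrable f :=
  hf.1.continuous.integrable_of_hasCompactSupport hf.2
lemma differentiable (hf : Nice f) : Differentiable ℝ f := hf.1.differentiable (by simp)
end Nice

lemma nice_Lgen (α β γ ρ₀ lam μ₀ : ℝ) {h : (Fin 4 → ℝ) → Matrix (Fin 4) (Fin 4) ℝ}
    {ξ : (Fin 4 → ℝ) → Fin 3 → ℝ} (hh : ∀ μ ν, Nice (fun x => h x μ ν))
    (hξ : ∀ i, Nice (fun x => ξ x i)) : Nice (Lgen α β γ ρ₀ lam μ₀ h ξ) := by
  unfold Lgen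
  refine Nice.add (Nice.add (Nice.sub (Nice.sub (Nice.add ?_ ?_) ?_) ?_) ?_) ?_
  · exact .const_mul _ (.sum fun μ => .sum fun ν => .sum fun ρ => ((hh _ _).pd _).sq)
  · exact .const_mul _ (.sum fun μ => (Nice.pd _ (.sum fun ν => hh _ _)).sq)
  · exact .mul (.const_mul _ (.sum fun ν => hh _ _))
      (.sum fun μ => .sum fun ν => .pd _ (.pd _ (hh _ _)))
  · exact .const_mul _ (.sum fun μ => .sq (.sum fun ν => (hh _ _).pd _))
  · exact .const_mul _ (.sum fun μ => .sum fun i => ((hξ _).pd _).sq)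
  · exact .const_mul _ (.sum fun i => .sum fun μ => .sum fun ν => .sum fun a =>
      .mul_const _ (.mul ((hh _ _).pd _) ((hξ _).pd _)))

/-- The polar form of the Lagrangian. -/
noncomputable def Lpol (α β γ ρ₀ lam μ₀ : ℝ)
    (h k : (Fin 4 → ℝ) → Matrix (Fin 4) (Fin 4) ℝ)
    (ξ η : (Fin 4 → ℝ) → Fin 3 → ℝ) (x : Fin 4 → ℝ) : ℝ :=
  ρ₀ * (∑ μ, ∑ ν, ∑ ρ, pd μ (fun y => h y ν ρ) x * pd μ (fun y => k y ν ρ) x)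
    + α * (∑ μ, pd μ (fun y => ∑ ν, h y ν ν) x * pd μ (fun y => ∑ ν, k y ν ν) x)
    - β * ((∑ ν, h x ν ν) * (∑ μ, ∑ ν, pd μ (fun z => pd ν (fun y => k y μ ν) z) x)
      + (∑ ν, k x ν ν) * (∑ μ, ∑ ν, pd μ (fun z => pd ν (fun y => h y μ ν) z) x))
    - 2 * γ * (∑ ν, (∑ μ, pd μ (fun y => h y μ ν) x) * (∑ μ, pd μ (fun y => k y μ ν) x))
    + lam * (∑ μ, ∑ i, pd μ (fun y => ξ y i) x * pd μ (fun y => η y i) x)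
    + μ₀ * ∑ i, ∑ μ, ∑ ν, ∑ α',
        (pd μ (fun y => h y μ ν) x * pd α' (fun y => η y i) x
          + pd μ (fun y => k y μ ν) x * pd α' (fun y => ξ y i) x) * Scan i α' ν

lemma pd_add_mul (μ : Fin 4) {f g : (Fin 4 → ℝ) → ℝ} (hf : Differentiable ℝ f)
    (hg : Differentiable ℝ g) (t : ℝ) (x) :
    pd μ (fun y => f y + t * g y) x = pd μ f x + t * pd μ g x := by
  unfold pd
  rw [fderiv_fun_add (hf x) ((hg x).const_mul t), fderiv_const_mul (hg x)]
  simp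

lemma sum_quad {ι : Type} [Fintype ι] (a b c : ι → ℝ) (t : ℝ) :
    ∑ i, (a i + t * b i + t ^ 2 * c i) = ∑ i, a i + t * ∑ i, b i + t ^ 2 * ∑ i, c i := by
  simp [Finset.sum_add_distrib, Finset.mul_sum]

lemma sum_lin {ι : Type} [Fintype ι] (a b : ι → ℝ) (t : ℝ) :
    ∑ i, (a i + t * b i) = ∑ i, a i + t * ∑ i, b i := by
  simp [Finset.sum_add_distrib, Finset.mul_sum]

lemma Lgen_expand (α β γ ρ₀ lam μ₀ : ℝ) {h k : (Fin 4 → ℝ) → Matrix (Fin 4) (Fin 4) ℝ}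
    {ξ η : (Fin 4 → ℝ) → Fin 3 → ℝ} (hh : ∀ μ ν, Nice (fun x => h x μ ν))
    (hk : ∀ μ ν, Nice (fun x => k x μ ν))
    (hξ : ∀ i, Nice (fun x => ξ x i)) (hη : ∀ i, Nice (fun x => η x i)) (t : ℝ) (x) :
    Lgen α β γ ρ₀ lam μ₀ (fun y => h y + t • k y) (fun y => ξ y + t • η y) x =
      Lgen α β γ ρ₀ lam μ₀ h ξ x + t * Lpol α β γ ρ₀ lam μ₀ h k ξ η x
        + t ^ 2 * Lgen α β γ ρ₀ lam μ₀ k η x := by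
  have e1 : ∀ μ ν ρ x, pd μ (fun y => h y ν ρ + t * k y ν ρ) x
      = pd μ (fun y => h y ν ρ) x + t * pd μ (fun y => k y ν ρ) x := fun μ ν ρ x =>
    pd_add_mul μ (hh ν ρ).differentiable (hk ν ρ).differentiable t x
  have e2 : ∀ μ i x, pd μ (fun y => ξ y i + t * η y i) x
      = pd μ (fun y => ξ y i) x + t * pd μ (fun y => η y i) x := fun μ i x =>
    pd_add_mul μ (hξ i).differentiable (hη i).differentiable t x
  have e3 : ∀ μ x, pd μ (fun y => ∑ ν, h y ν ν + t * ∑ ν, k y ν ν) x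
      = pd μ (fun y => ∑ ν, h y ν ν) x + t * pd μ (fun y => ∑ ν, k y ν ν) x := fun μ x =>
    pd_add_mul μ (Nice.sum fun ν => hh ν ν).differentiable
      (Nice.sum fun ν => hk ν ν).differentiable t x
  have e4 : ∀ μ ν ρ σ x, pd μ (fun z => pd ν (fun y => h y ρ σ) z + t * pd ν (fun y => k y ρ σ) z) x
      = pd μ (fun z => pd ν (fun y => h y ρ σ) z) x
        + t * pd μ (fun z => pd ν (fun y => k y ρ σ) z) x := fun μ ν ρ σ x =>
    pd_add_mul μ ((hh ρ σ).pd ν).differentiable ((hk ρ σ).pd ν).differentiable t x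
  have q1 : ∀ a b : ℝ, (a + t * b) ^ 2 = a ^ 2 + t * (2 * (a * b)) + t ^ 2 * b ^ 2 := by
    intros; ring
  have q2 : ∀ a b c d s : ℝ, (a + t * b) * (c + t * d) * s
      = a * c * s + t * ((a * d + b * c) * s) + t ^ 2 * (b * d * s) := by
    intros; ring
  unfold Lgen Lpol
  simp only [Matrix.add_apply, Matrix.smul_apply, Pi.add_apply, Pi.smul_apply, smul_eq_mul,
    sum_lin, e1, e2, e3, e4, q1, q2, ← Finset.mul_sum]
  ring

lemma nice_deltaH {X : (Fin 4 → ℝ) → Fin 4 → ℝ} (hX : ∀ μ, Nice (fun x => X x μ)) (μ ν) :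
    Nice (fun x => deltaH X x μ ν) := by
  simp only [deltaH, Matrix.of_apply]
  exact .const_mul _ (.add ((hX _).pd _) ((hX _).pd _))

lemma nice_deltaXi {X : (Fin 4 → ℝ) → Fin 4 → ℝ} (hX : ∀ μ, Nice (fun x => X x μ)) (i) :
    Nice (fun x => deltaXi X x i) := by
  simp only [deltaXi]
  exact .const_mul _ (.sum fun μ => .sum fun ν => .const_mul _ ((hX _).pd _))

lemma deriv_quad (α β γ ρ₀ lam μ₀ : ℝ) {h k : (Fin 4 → ℝ) → Matrix (Fin 4) (Fin 4) ℝ}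
    {ξ η : (Fin 4 → ℝ) → Fin 3 → ℝ} (hh : ∀ μ ν, Nice (fun x => h x μ ν))
    (hk : ∀ μ ν, Nice (fun x => k x μ ν))
    (hξ : ∀ i, Nice (fun x => ξ x i)) (hη : ∀ i, Nice (fun x => η x i)) :
    deriv (fun t : ℝ => ∫ x, Lgen α β γ ρ₀ lam μ₀ (fun y => h y + t • k y)
      (fun y => ξ y + t • η y) x) 0 = ∫ x, Lpol α β γ ρ₀ lam μ₀ h k ξ η x := by
  have iA := (nice_Lgen α β γ ρ₀ lam μ₀ hh hξ).integrable
  have iC := (nice_Lgen α β γ ρ₀ lam μ₀ hk hη).integrable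
  have iB : Integrable (Lpol α β γ ρ₀ lam μ₀ h k ξ η) := by
    have i1 : Integrable (Lgen α β γ ρ₀ lam μ₀ (fun y => h y + (1:ℝ) • k y)
        (fun y => ξ y + (1:ℝ) • η y)) := by
      refine (nice_Lgen α β γ ρ₀ lam μ₀ ?_ ?_).integrable
      · intro μ ν; simpa using (hh μ ν).add (hk μ ν)
      · intro i; simpa using (hξ i).add (hη i)
    refine ((i1.sub iA).sub iC).congr (Filter.Eventually.of_forall fun x => ?_)
    have := Lgen_expand α β γ ρ₀ lam μ₀ hh hk hξ hη 1 x
    simp only [Pi.sub_apply, this]; ring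
  simp_rw [Lgen_expand α β γ ρ₀ lam μ₀ hh hk hξ hη]
  have : ∀ t : ℝ, ∫ x, (Lgen α β γ ρ₀ lam μ₀ h ξ x + t * Lpol α β γ ρ₀ lam μ₀ h k ξ η x
        + t ^ 2 * Lgen α β γ ρ₀ lam μ₀ k η x) = (∫ x, Lgen α β γ ρ₀ lam μ₀ h ξ x)
        + t * (∫ x, Lpol α β γ ρ₀ lam μ₀ h k ξ η x)
        + t ^ 2 * (∫ x, Lgen α β γ ρ₀ lam μ₀ k η x) := by
    intro t
    have iAB : Integrable (fun x => Lgen α β γ ρ₀ lam μ₀ h ξ x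
        + t * Lpol α β γ ρ₀ lam μ₀ h k ξ η x) := iA.add (iB.const_mul t)
    rw [integral_add iAB (iC.const_mul _),
      integral_add iA (iB.const_mul t), integral_const_mul, integral_const_mul]
  simp_rw [this]
  generalize (∫ x, Lgen α β γ ρ₀ lam μ₀ h ξ x) = a
  generalize (∫ x, Lpol α β γ ρ₀ lam μ₀ h k ξ η x) = b
  generalize (∫ x, Lgen α β γ ρ₀ lam μ₀ k η x) = c
  have h1 : HasDerivAt (fun t : ℝ => a + t * b + t ^ 2 * c) (0 + 1 * b + (2 * 0 ^ 1 * 1) * c) 0 := by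
    have := (((hasDerivAt_const (0:ℝ) a).fun_add ((hasDerivAt_id' (0:ℝ)).mul_const b)).fun_add
      (((hasDerivAt_id' (0:ℝ)).fun_pow 2).mul_const c))
    simpa using this
  simpa using h1.deriv

lemma pd_congr (μ : Fin 4) {f g : (Fin 4 → ℝ) → ℝ} {x} (e : f =ᶠ[nhds x] g) :
    pd μ f =ᶠ[nhds x] pd μ g := by
  filter_upwards [e.fderiv (𝕜 := ℝ)] with y hy
  simp [pd, hy]

lemma ibp (μ : Fin 4) {f g : (Fin 4 → ℝ) → ℝ} (hf : ContDiff ℝ (⊤ : ℕ∞) f) (hg : Nice g) :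
    ∫ x, f x * pd μ g x = - ∫ x, pd μ f x * g x := by
  have hpf : ContDiff ℝ (⊤ : ℕ∞) (fun x => pd μ f x) := by
    unfold pd
    exact (hf.fderiv_right (m := (⊤ : ℕ∞)) le_rfl).clm_apply contDiff_const
  exact integral_mul_fderiv_eq_neg_fderiv_mul_of_integrable
    (Nice.smooth_mul hpf hg).integrable (Nice.smooth_mul hf (hg.pd μ)).integrable
    (Nice.smooth_mul hf hg).integrable (fun x _ => hf.differentiable (by simp) x) (fun x _ => hg.differentiable x)

lemma Lpol_congr (α β γ ρ₀ lam μ₀ : ℝ) {h h' k k' : (Fin 4 → ℝ) → Matrix (Fin 4) (Fin 4) ℝ}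
    {ξ ξ' η η' : (Fin 4 → ℝ) → Fin 3 → ℝ} {x : Fin 4 → ℝ} (eh : h =ᶠ[nhds x] h')
    (ek : k =ᶠ[nhds x] k') (eξ : ξ =ᶠ[nhds x] ξ') (eη : η =ᶠ[nhds x] η') :
    Lpol α β γ ρ₀ lam μ₀ h k ξ η x = Lpol α β γ ρ₀ lam μ₀ h' k' ξ' η' x := by
  have c1 : ∀ {h h' : (Fin 4 → ℝ) → Matrix (Fin 4) (Fin 4) ℝ} (_ : h =ᶠ[nhds x] h') (μ ν ρ),
      pd μ (fun y => h y ν ρ) =ᶠ[nhds x] pd μ (fun y => h' y ν ρ) := fun e μ ν ρ =>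
    pd_congr μ (e.fun_comp (fun A => A ν ρ))
  have c2 : ∀ {h h' : (Fin 4 → ℝ) → Matrix (Fin 4) (Fin 4) ℝ} (_ : h =ᶠ[nhds x] h') (μ),
      pd μ (fun y => ∑ ν, h y ν ν) x = pd μ (fun y => ∑ ν, h' y ν ν) x := fun e μ =>
    (pd_congr μ (e.fun_comp (fun A => ∑ ν, A ν ν))).eq_of_nhds
  have c3 : ∀ {h h' : (Fin 4 → ℝ) → Matrix (Fin 4) (Fin 4) ℝ} (_ : h =ᶠ[nhds x] h') (μ σ ν ρ),
      pd σ (fun z => pd μ (fun y => h y ν ρ) z) x = pd σ (fun z => pd μ (fun y => h' y ν ρ) z) x :=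
    fun e μ σ ν ρ => (pd_congr σ (c1 e μ ν ρ)).eq_of_nhds
  have c4 : ∀ {h h' : (Fin 4 → ℝ) → Fin 3 → ℝ} (_ : h =ᶠ[nhds x] h') (μ i),
      pd μ (fun y => h y i) x = pd μ (fun y => h' y i) x := fun e μ i =>
    (pd_congr μ (e.fun_comp (fun A => A i))).eq_of_nhds
  unfold Lpol
  simp only [(c1 eh _ _ _).eq_of_nhds, (c1 ek _ _ _).eq_of_nhds, c2 eh, c2 ek, c3 eh, c3 ek,
    c4 eξ, c4 eη, eh.eq_of_nhds, ek.eq_of_nhds]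

lemma pd_const (μ : Fin 4) (c : ℝ) (x) : pd μ (fun _ => c) x = 0 := by simp [pd]

lemma Lpol_zero (α β γ ρ₀ lam μ₀ : ℝ) (k : (Fin 4 → ℝ) → Matrix (Fin 4) (Fin 4) ℝ)
    (η : (Fin 4 → ℝ) → Fin 3 → ℝ) (x : Fin 4 → ℝ) :
    Lpol α β γ ρ₀ lam μ₀ (fun _ => 0) k (fun _ => 0) η x = 0 := by
  simp [Lpol, pd_const]

lemma deltaH_congr {X Y : (Fin 4 → ℝ) → Fin 4 → ℝ} {x} (e : X =ᶠ[nhds x] Y) :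
    deltaH X =ᶠ[nhds x] deltaH Y := by
  filter_upwards [e.eventuallyEq_nhds] with y hy
  have c : ∀ μ ν, pd μ (fun y => X y ν) y = pd μ (fun y => Y y ν) y := fun μ ν =>
    (pd_congr μ (hy.fun_comp (fun A => A ν))).eq_of_nhds
  simp only [deltaH, c]

lemma deltaXi_congr {X Y : (Fin 4 → ℝ) → Fin 4 → ℝ} {x} (e : X =ᶠ[nhds x] Y) :
    deltaXi X =ᶠ[nhds x] deltaXi Y := by
  filter_upwards [e.eventuallyEq_nhds] with y hy
  have c : ∀ μ ν, pd μ (fun y => X y ν) y = pd μ (fun y => Y y ν) y := fun μ ν =>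
    (pd_congr μ (hy.fun_comp (fun A => A ν))).eq_of_nhds
  funext i
  simp only [deltaXi, c]

/-- The invariance hypothesis, localized so that polynomial vector fields may be used. -/
def LInv (α β γ ρ₀ lam μ₀ : ℝ) : Prop :=
  ∀ (h : (Fin 4 → ℝ) → Matrix (Fin 4) (Fin 4) ℝ),
      (∀ x, (h x)ᵀ = h x) →
      (∀ μ ν, ContDiff ℝ (⊤ : ℕ∞) (fun x => h x μ ν)) →
      (∀ μ ν, HasCompactSupport (fun x => h x μ ν)) →
      ∀ (ξ : (Fin 4 → ℝ) → Fin 3 → ℝ),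
      (∀ i, ContDiff ℝ (⊤ : ℕ∞) (fun x => ξ x i)) →
      (∀ i, HasCompactSupport (fun x => ξ x i)) →
      ∀ (X : (Fin 4 → ℝ) → Fin 4 → ℝ),
      (∀ μ, ContDiff ℝ (⊤ : ℕ∞) (fun x => X x μ)) →
      (∀ μ, HasCompactSupport (fun x => X x μ)) →
      deriv (fun t : ℝ =>
        ∫ x : Fin 4 → ℝ,
          Lgen α β γ ρ₀ lam μ₀ (fun y => h y + t • deltaH X y)
            (fun y => ξ y + t • deltaXi X y) x) 0 = 0

lemma key {α β γ ρ₀ lam μ₀ : ℝ} (hinv : LInv α β γ ρ₀ lam μ₀)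
    {u : (Fin 4 → ℝ) → ℝ} (hu : Nice u) (hs : tsupport u ⊆ Metric.ball 0 2)
    (E : Matrix (Fin 4) (Fin 4) ℝ) (hE : Eᵀ = E) (e : Fin 3 → ℝ)
    (P : (Fin 4 → ℝ) → Fin 4 → ℝ) (hP : ∀ μ, ContDiff ℝ (⊤ : ℕ∞) (fun x => P x μ)) :
    ∫ x, Lpol α β γ ρ₀ lam μ₀ (fun y => u y • E) (deltaH P) (fun y => u y • e) (deltaXi P) x
      = 0 := by
  let χ : ContDiffBump (0 : Fin 4 → ℝ) := ⟨2, 3, by norm_num, by norm_num⟩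
  have nχ : Nice χ := ⟨χ.contDiff, χ.hasCompactSupport⟩
  have nX : ∀ μ, Nice (fun x => (fun y => χ y • P y) x μ) := fun μ => by
    have := Nice.smooth_mul (hP μ) nχ
    simpa [mul_comm] using this
  have nh : ∀ μ ν, Nice (fun x => (u x • E) μ ν) := fun μ ν => by
    simpa using hu.mul_const (E μ ν)
  have nξ : ∀ i, Nice (fun x => (u x • e) i) := fun i => by
    simpa using hu.mul_const (e i)
  have h0 := hinv (fun y => u y • E) (fun x => by simp [hE]) (fun μ ν => (nh μ ν).1)
    (fun μ ν => (nh μ ν).2) (fun y => u y • e) (fun i => (nξ i).1) (fun i => (nξ i).2)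
    (fun y => χ y • P y) (fun i => (nX i).1) (fun i => (nX i).2)
  rw [deriv_quad α β γ ρ₀ lam μ₀ nh (nice_deltaH nX) nξ (nice_deltaXi nX)] at h0
  rw [← h0]
  refine integral_congr_ae (Filter.Eventually.of_forall fun x => ?_)
  by_cases hx : x ∈ tsupport u
  · have hb := hs hx
    have e1 : P =ᶠ[nhds x] (fun y => χ y • P y) := by
      filter_upwards [Metric.isOpen_ball.mem_nhds hb] with y hy
      rw [χ.one_of_mem_closedBall (Metric.ball_subset_closedBall hy), one_smul]
    exact Lpol_congr _ _ _ _ _ _ .rfl (deltaH_congr e1) .rfl (deltaXi_congr e1)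
  · have e1 : u =ᶠ[nhds x] fun _ => 0 := notMem_tsupport_iff_eventuallyEq.1 hx
    have e2 : (fun y => u y • E) =ᶠ[nhds x] fun _ => 0 := by
      filter_upwards [e1] with y hy; simp [hy]
    have e3 : (fun y => u y • e) =ᶠ[nhds x] fun _ => 0 := by
      filter_upwards [e1] with y hy; simp [hy]
    rw [Lpol_congr _ _ _ _ _ _ e2 .rfl e3 .rfl, Lpol_congr _ _ _ _ _ _ e2 .rfl e3 .rfl,
      Lpol_zero, Lpol_zero]

lemma pd_mul (μ : Fin 4) {f g : (Fin 4 → ℝ) → ℝ} {x} (hf : DifferentiableAt ℝ f x)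
    (hg : DifferentiableAt ℝ g x) :
    pd μ (fun y => f y * g y) x = f x * pd μ g x + g x * pd μ f x := by
  unfold pd
  rw [fderiv_fun_mul hf hg]
  simp

lemma pd_pow (μ : Fin 4) {f : (Fin 4 → ℝ) → ℝ} {x} (hf : DifferentiableAt ℝ f x) (n : ℕ) :
    pd μ (fun y => f y ^ n) x = n * f x ^ (n - 1) * pd μ f x := by
  unfold pd
  rw [fderiv_fun_pow _ hf]
  simp

lemma pd_coord (μ i : Fin 4) (x) : pd μ (fun y => y i) x = if i = μ then 1 else 0 := by
  unfold pd
  have : HasFDerivAt (fun y : Fin 4 → ℝ => y i) (ContinuousLinearMap.proj (R := ℝ) (φ := fun _ : Fin 4 => ℝ) i) x :=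
    (ContinuousLinearMap.proj (R := ℝ) (φ := fun _ : Fin 4 => ℝ) i).hasFDerivAt
  rw [this.fderiv]
  simp [Pi.single_apply]

lemma pd_neg (μ : Fin 4) (f : (Fin 4 → ℝ) → ℝ) (x) : pd μ (fun y => - f y) x = - pd μ f x := by
  simp [pd]

section eval
variable (α β γ ρ₀ lam μ₀ : ℝ) (u : (Fin 4 → ℝ) → ℝ) (x : Fin 4 → ℝ)

lemma eval1 : Lpol α β γ ρ₀ lam μ₀ (fun y => u y • 0)
    (deltaH (fun y => ![y 3 * y 1 ^ 2, 0, 0, 0]))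
    (fun y => u y • ![1, 0, 0]) (deltaXi (fun y => ![y 3 * y 1 ^ 2, 0, 0, 0])) x
    = (lam / 2) * (x 1 * pd 1 u x) + μ₀ * (x 3 * pd 3 u x) := by
  have hη : deltaXi (fun y => ![y 3 * y 1 ^ 2, 0, 0, 0])
      = fun y => ![(1 / 4) * y 1 ^ 2, (0 : ℝ), (1 / 2) * (y 1 * y 3)] := by
    ext y i
    fin_cases i <;>
    simp (disch := fun_prop) [deltaXi, Fin.sum_univ_four, Scan, pd_mul, pd_pow, pd_coord, pd_const]
    <;> ring
  have hk : deltaH (fun y => ![y 3 * y 1 ^ 2, 0, 0, 0])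
      = fun y => !![0, y 1 * y 3, 0, (1 / 2) * y 1 ^ 2; y 1 * y 3, 0, 0, 0; 0, 0, 0, 0;
        (1 / 2) * y 1 ^ 2, 0, 0, 0] := by
    ext y i j
    fin_cases i <;> fin_cases j <;>
    simp (disch := fun_prop) [deltaH, pd_mul, pd_pow, pd_coord, pd_const]
    <;> ring
  rw [hη, hk]
  simp (disch := fun_prop) [Lpol, Fin.sum_univ_four, Fin.sum_univ_three, Scan, pd_mul, pd_pow,
    pd_coord, pd_const, pd_neg]
  ring

lemma eval2 : Lpol α β γ ρ₀ lam μ₀ (fun y => u y • !![0, 1, 0, 0; 1, 0, 0, 0; 0, 0, 0, 0; 0, 0, 0, 0])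
    (deltaH (fun y => ![y 1 * y 2 ^ 2, 0, 0, 0]))
    (fun y => u y • 0) (deltaXi (fun y => ![y 1 * y 2 ^ 2, 0, 0, 0])) x
    = (2 * ρ₀) * (x 2 * pd 2 u x) + (μ₀ / 2 - 2 * γ) * (x 1 * pd 1 u x) := by
  have hη : deltaXi (fun y => ![y 1 * y 2 ^ 2, 0, 0, 0])
      = fun y => ![(0 : ℝ), -(1 / 2) * (y 1 * y 2), (1 / 4) * y 2 ^ 2] := by
    ext y i
    fin_cases i <;>
    simp (disch := fun_prop) [deltaXi, Fin.sum_univ_four, Scan, pd_mul, pd_pow, pd_coord, pd_const]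
    <;> ring
  have hk : deltaH (fun y => ![y 1 * y 2 ^ 2, 0, 0, 0])
      = fun y => !![0, (1 / 2) * y 2 ^ 2, y 1 * y 2, 0; (1 / 2) * y 2 ^ 2, 0, 0, 0; y 1 * y 2, 0, 0, 0;
        0, 0, 0, 0] := by
    ext y i j
    fin_cases i <;> fin_cases j <;>
    simp (disch := fun_prop) [deltaH, pd_mul, pd_pow, pd_coord, pd_const]
    <;> ring
  rw [hη, hk]
  simp (disch := fun_prop) [Lpol, Fin.sum_univ_four, Fin.sum_univ_three, Scan, pd_mul, pd_pow,
    pd_coord, pd_const, pd_neg]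
  ring

lemma eval3 : Lpol α β γ ρ₀ lam μ₀ (fun y => u y • !![1, 0, 0, 0; 0, 0, 0, 0; 0, 0, 0, 0; 0, 0, 0, 0])
    (deltaH (fun y => ![0, y 1 ^ 3, 0, 0]))
    (fun y => u y • 0) (deltaXi (fun y => ![0, y 1 ^ 3, 0, 0])) x
    = (6 * α) * (x 1 * pd 1 u x) + (- (6 * β)) * u x
      + (- (3 * β)) * (x 1 ^ 2 * pd 0 (fun z => pd 0 u z) x) := by
  have hη : deltaXi (fun y => ![0, y 1 ^ 3, 0, 0])
      = fun y => ![(0 : ℝ), 0, 0] := by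
    ext y i
    fin_cases i <;>
    simp (disch := fun_prop) [deltaXi, Fin.sum_univ_four, Scan, pd_mul, pd_pow, pd_coord, pd_const]
    <;> ring
  have hk : deltaH (fun y => ![0, y 1 ^ 3, 0, 0])
      = fun y => !![0, 0, 0, 0; 0, 3 * y 1 ^ 2, 0, 0; 0, 0, 0, 0; 0, 0, 0, 0] := by
    ext y i j
    fin_cases i <;> fin_cases j <;>
    simp (disch := fun_prop) [deltaH, pd_mul, pd_pow, pd_coord, pd_const]
    <;> ring
  rw [hη, hk]
  simp (disch := fun_prop) [Lpol, Fin.sum_univ_four, Fin.sum_univ_three, Scan, pd_mul, pd_pow,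
    pd_coord, pd_const, pd_neg]
  ring

lemma eval4 : Lpol α β γ ρ₀ lam μ₀ (fun y => u y • !![0, 1, 0, 0; 1, 0, 0, 0; 0, 0, 0, 0; 0, 0, 0, 0])
    (deltaH (fun y => ![y 1 * y 0 ^ 2, 0, 0, 0]))
    (fun y => u y • 0) (deltaXi (fun y => ![y 1 * y 0 ^ 2, 0, 0, 0])) x
    = (2 * ρ₀ - 2 * γ - μ₀ / 2) * (x 0 * pd 0 u x) + (- (4 * γ)) * (x 1 * pd 1 u x)
      + (- (2 * β)) * (x 0 * x 1 * pd 0 (fun z => pd 1 u z) x)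
      + (- (2 * β)) * (x 0 * x 1 * pd 1 (fun z => pd 0 u z) x) := by
  have hη : deltaXi (fun y => ![y 1 * y 0 ^ 2, 0, 0, 0])
      = fun y => ![(0 : ℝ), 0, (1 / 4) * y 0 ^ 2] := by
    ext y i
    fin_cases i <;>
    simp (disch := fun_prop) [deltaXi, Fin.sum_univ_four, Scan, pd_mul, pd_pow, pd_coord, pd_const]
    <;> ring
  have hk : deltaH (fun y => ![y 1 * y 0 ^ 2, 0, 0, 0])
      = fun y => !![2 * (y 0 * y 1), (1 / 2) * y 0 ^ 2, 0, 0; (1 / 2) * y 0 ^ 2, 0, 0, 0; 0, 0, 0, 0;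
        0, 0, 0, 0] := by
    ext y i j
    fin_cases i <;> fin_cases j <;>
    simp (disch := fun_prop) [deltaH, pd_mul, pd_pow, pd_coord, pd_const]
    <;> ring
  rw [hη, hk]
  simp (disch := fun_prop) [Lpol, Fin.sum_univ_four, Fin.sum_univ_three, Scan, pd_mul, pd_pow,
    pd_coord, pd_const, pd_neg]
  ring
end eval

lemma int1 {u : (Fin 4 → ℝ) → ℝ} (hu : Nice u) (a : Fin 4) :
    ∫ x, x a * pd a u x = - ∫ x, u x := by
  rw [ibp a (f := fun x => x a) (by fun_prop) hu]
  simp [pd_coord]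

lemma int2 {u : (Fin 4 → ℝ) → ℝ} (hu : Nice u) :
    ∫ x : Fin 4 → ℝ, x 1 ^ 2 * pd 0 (fun z => pd 0 u z) x = 0 := by
  rw [ibp 0 (f := fun x => x 1 ^ 2) (by fun_prop) (hu.pd 0)]
  simp (disch := fun_prop) [pd_pow, pd_coord]

lemma int3 {u : (Fin 4 → ℝ) → ℝ} (hu : Nice u) :
    ∫ x : Fin 4 → ℝ, x 0 * x 1 * pd 0 (fun z => pd 1 u z) x = ∫ x, u x := by
  rw [ibp 0 (f := fun x => x 0 * x 1) (by fun_prop) (hu.pd 1)]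
  simp (disch := fun_prop) [pd_mul, pd_coord, int1 hu 1]

lemma int4 {u : (Fin 4 → ℝ) → ℝ} (hu : Nice u) :
    ∫ x : Fin 4 → ℝ, x 0 * x 1 * pd 1 (fun z => pd 0 u z) x = ∫ x, u x := by
  rw [ibp 1 (f := fun x => x 0 * x 1) (by fun_prop) (hu.pd 0)]
  simp (disch := fun_prop) [pd_mul, pd_coord, int1 hu 0]

lemma smooth_vec (f : Fin 4 → (Fin 4 → ℝ) → ℝ) (hf : ∀ i, ContDiff ℝ (⊤ : ℕ∞) (f i)) (μ : Fin 4) :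
    ContDiff ℝ (⊤ : ℕ∞) (fun x => ![f 0 x, f 1 x, f 2 x, f 3 x] μ) := by
  fin_cases μ
  · exact hf 0
  · exact hf 1
  · exact hf 2
  · exact hf 3

/-- if the general second-order Lagrangian is invariant under
linearised diffeomorphisms, then its coefficients satisfy
`β = −α = ρ₀ + μ₀/2`, `γ = ρ₀ + μ₀/4`, `λ = −2μ₀`. -/
theorem diffeo_invariance_fixes_coefficients (α β γ ρ₀ lam μ₀ : ℝ)
    (hinv : ∀ (h : (Fin 4 → ℝ) → Matrix (Fin 4) (Fin 4) ℝ),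
      (∀ x, (h x)ᵀ = h x) →
      (∀ μ ν, ContDiff ℝ (⊤ : ℕ∞) (fun x => h x μ ν)) →
      (∀ μ ν, HasCompactSupport (fun x => h x μ ν)) →
      ∀ (ξ : (Fin 4 → ℝ) → Fin 3 → ℝ),
      (∀ i, ContDiff ℝ (⊤ : ℕ∞) (fun x => ξ x i)) →
      (∀ i, HasCompactSupport (fun x => ξ x i)) →
      ∀ (X : (Fin 4 → ℝ) → Fin 4 → ℝ),
      (∀ μ, ContDiff ℝ (⊤ : ℕ∞) (fun x => X x μ)) →
      (∀ μ, HasCompactSupport (fun x => X x μ)) →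
      deriv (fun t : ℝ =>
        ∫ x : Fin 4 → ℝ,
          Lgen α β γ ρ₀ lam μ₀ (fun y => h y + t • deltaH X y)
            (fun y => ξ y + t • deltaXi X y) x) 0 = 0) :
    β = -α ∧ β = ρ₀ + μ₀ / 2 ∧ γ = ρ₀ + μ₀ / 4 ∧ lam = -2 * μ₀ := by
  have hinv' : LInv α β γ ρ₀ lam μ₀ := hinv
  let w : ContDiffBump (0 : Fin 4 → ℝ) := ⟨1 / 2, 1, by norm_num, by norm_num⟩
  obtain ⟨u, hu, hs, hc⟩ : ∃ u : (Fin 4 → ℝ) → ℝ, Nice u ∧ tsupport u ⊆ Metric.ball 0 2 ∧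
      0 < ∫ x, u x := by
    refine ⟨w, ⟨w.contDiff, w.hasCompactSupport⟩, ?_, w.integral_pos⟩
    rw [w.tsupport_eq]
    exact Metric.closedBall_subset_ball (by norm_num [w])
  have i1 : ∀ a : Fin 4, Integrable (fun x : Fin 4 → ℝ => x a * pd a u x) := fun a =>
    (Nice.smooth_mul (f := fun x => x a) (by fun_prop) (hu.pd a)).integrable
  have i2 : Integrable (fun x : Fin 4 → ℝ => x 1 ^ 2 * pd 0 (fun z => pd 0 u z) x) :=
    (Nice.smooth_mul (f := fun x => x 1 ^ 2) (by fun_prop) ((hu.pd 0).pd 0)).integrable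
  have i3 : ∀ a b : Fin 4,
      Integrable (fun x : Fin 4 → ℝ => x 0 * x 1 * pd a (fun z => pd b u z) x) := fun a b =>
    (Nice.smooth_mul (f := fun x => x 0 * x 1) (by fun_prop) ((hu.pd b).pd a)).integrable
  have k1 := key hinv' hu hs 0 (by simp) ![1, 0, 0] (fun y => ![y 3 * y 1 ^ 2, 0, 0, 0])
    (smooth_vec ![fun y => y 3 * y 1 ^ 2, fun _ => 0, fun _ => 0, fun _ => 0]
      (by intro i; fin_cases i <;> simp <;> fun_prop))
  have k2 := key hinv' hu hs !![0, 1, 0, 0; 1, 0, 0, 0; 0, 0, 0, 0; 0, 0, 0, 0]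
    (by ext i j; fin_cases i <;> fin_cases j <;> rfl) 0 (fun y => ![y 1 * y 2 ^ 2, 0, 0, 0])
    (smooth_vec ![fun y => y 1 * y 2 ^ 2, fun _ => 0, fun _ => 0, fun _ => 0]
      (by intro i; fin_cases i <;> simp <;> fun_prop))
  have k3 := key hinv' hu hs !![1, 0, 0, 0; 0, 0, 0, 0; 0, 0, 0, 0; 0, 0, 0, 0]
    (by ext i j; fin_cases i <;> fin_cases j <;> rfl) 0 (fun y => ![0, y 1 ^ 3, 0, 0])
    (smooth_vec ![fun _ => 0, fun y => y 1 ^ 3, fun _ => 0, fun _ => 0]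
      (by intro i; fin_cases i <;> simp <;> fun_prop))
  have k4 := key hinv' hu hs !![0, 1, 0, 0; 1, 0, 0, 0; 0, 0, 0, 0; 0, 0, 0, 0]
    (by ext i j; fin_cases i <;> fin_cases j <;> rfl) 0 (fun y => ![y 1 * y 0 ^ 2, 0, 0, 0])
    (smooth_vec ![fun y => y 1 * y 0 ^ 2, fun _ => 0, fun _ => 0, fun _ => 0]
      (by intro i; fin_cases i <;> simp <;> fun_prop))
  simp only [eval1] at k1
  simp only [eval2] at k2
  simp only [eval3] at k3
  simp only [eval4] at k4
  rw [integral_add ((i1 1).const_mul _) ((i1 3).const_mul _), integral_const_mul,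
    integral_const_mul, int1 hu, int1 hu] at k1
  rw [integral_add ((i1 2).const_mul _) ((i1 1).const_mul _), integral_const_mul,
    integral_const_mul, int1 hu, int1 hu] at k2
  rw [integral_add (((i1 1).const_mul _).fun_add (hu.integrable.const_mul _)) (i2.const_mul _),
    integral_add ((i1 1).const_mul _) (hu.integrable.const_mul _), integral_const_mul,
    integral_const_mul, integral_const_mul, int1 hu, int2 hu] at k3
  rw [integral_add ((((i1 0).const_mul _).fun_add ((i1 1).const_mul _)).fun_add
      ((i3 0 1).const_mul _)) ((i3 1 0).const_mul _),
    integral_add (((i1 0).const_mul _).fun_add ((i1 1).const_mul _)) ((i3 0 1).const_mul _),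
    integral_add ((i1 0).const_mul _) ((i1 1).const_mul _), integral_const_mul,
    integral_const_mul, integral_const_mul, integral_const_mul, int1 hu, int1 hu, int3 hu,
    int4 hu] at k4
  generalize (∫ x, u x) = c at *
  have r1 : lam / 2 + μ₀ = 0 := (mul_eq_zero.1 (by linarith : c * (lam / 2 + μ₀) = 0)).resolve_left hc.ne'
  have r2 : 2 * ρ₀ + μ₀ / 2 - 2 * γ = 0 :=
    (mul_eq_zero.1 (by linarith : c * (2 * ρ₀ + μ₀ / 2 - 2 * γ) = 0)).resolve_left hc.ne'
  have r3 : α + β = 0 := (mul_eq_zero.1 (by linarith : c * (α + β) = 0)).resolve_left hc.ne'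
  have r4 : - (2 * ρ₀) + 6 * γ + μ₀ / 2 - 4 * β = 0 :=
    (mul_eq_zero.1 (by linarith : c * (- (2 * ρ₀) + 6 * γ + μ₀ / 2 - 4 * β) = 0)).resolve_left hc.ne'
  refine ⟨?_, ?_, ?_, ?_⟩ <;> linarith
end
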